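/- arXiv:2504.09560 — 3 statements merged into one kernel-verified Lean document; each statement's English description precedes it below -/
import Mathlib

section
/- The plethysm e_k ∘ e₂ equals the sum of Schur functions s_{Γ(β)} over all strict partitions β of k, where Γ(β) has Frobenius coordinates (β₁−1, β₂−1, … | β₁, β₂, …). -/
open MvPolynomial Finset

/-- The ring of symmetric functions (with rational coefficients), realized as the free
commutative `ℚ`-algebra on the complete homogeneous symmetric functions `h₁, h₂, …`,
where the variable `n : ℕ` corresponds to `h_{n+1}`. -/
abbrev SymFn : Type := MvPolynomial ℕ ℚ

/-- The complete homogeneous symmetric function `h_n`, with `h_n = 0` for `n < 0`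
and `h_0 = 1`. -/
noncomputable def hh (n : ℤ) : SymFn :=
  if n < 0 then 0 else if n = 0 then 1 else MvPolynomial.X (n.toNat - 1)

/-- The power sum symmetric functions, defined from the `h`'s by Newton's identities:
`p_k = k h_k - ∑_{i=1}^{k-1} h_i p_{k-i}`. -/
noncomputable def pp : ℕ → SymFn
  | 0 => 0
  | (k+1) => ((k : ℚ) + 1) • hh (k+1) - ∑ i ∈ Finset.range k, hh (i+1) * pp (k - i)
  decreasing_by exact Nat.lt_succ_of_le (Nat.sub_le _ _)

/-- `h_m` written as a polynomial in the power sums (the variable `j` stands for `p_{j+1}`),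
via the recursion `m h_m = ∑_{i=1}^{m} p_i h_{m-i}`. -/
noncomputable def hInP : ℕ → MvPolynomial ℕ ℚ
  | 0 => 1
  | (m+1) => ((m : ℚ) + 1)⁻¹ •
      ∑ i ∈ Finset.range (m+1), MvPolynomial.X i * hInP (m - i)
  decreasing_by exact Nat.lt_succ_of_le (Nat.sub_le _ _)

/-- The `k`-th Adams operation: the algebra endomorphism of `SymFn` determined by
`p_m ↦ p_{k m}` on power sums. -/
noncomputable def adams (k : ℕ) : SymFn →ₐ[ℚ] SymFn :=
  aeval fun m => (aeval fun j => pp (k * (j+1))) (hInP (m+1))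

/-- The plethysm `h_k ∘ g`, via the recursion
`k (h_k ∘ g) = ∑_{i=1}^{k} (p_i ∘ g) (h_{k-i} ∘ g)`, where `p_i ∘ g = adams i g`. -/
noncomputable def hPleth (g : SymFn) : ℕ → SymFn
  | 0 => 1
  | (k+1) => ((k : ℚ) + 1)⁻¹ •
      ∑ i ∈ Finset.range (k+1), adams (i+1) g * hPleth g (k - i)
  decreasing_by exact Nat.lt_succ_of_le (Nat.sub_le _ _)

/-- The (outer) plethysm `f ∘ g` of symmetric functions: the algebra homomorphism
in the left argument sending `h_k ↦ h_k ∘ g`. -/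
noncomputable def pleth (f g : SymFn) : SymFn := aeval (fun m => hPleth g (m+1)) f

/-- The elementary symmetric functions, via `e_k = ∑_{i=1}^{k} (-1)^{i-1} h_i e_{k-i}`. -/
noncomputable def ee : ℕ → SymFn
  | 0 => 1
  | (k+1) => ∑ i ∈ Finset.range (k+1), ((-1 : ℚ))^i • (hh (i+1) * ee (k - i))
  decreasing_by exact Nat.lt_succ_of_le (Nat.sub_le _ _)

/-- The parts of a multiset, as a weakly decreasing list. -/
def sortedParts (m : Multiset ℕ) : List ℕ := (m.sort (· ≤ ·)).reverse

/-- The Schur function `s_m`, via the Jacobi–Trudi determinant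
`s_λ = det (h_{λ_i + j - i})`. -/
noncomputable def schur (m : Multiset ℕ) : SymFn :=
  Matrix.det (Matrix.of fun i j : Fin (Multiset.card m) =>
    hh (((sortedParts m).getD i 0 : ℤ) + (j : ℤ) - (i : ℤ)))

/-- A multiset of naturals is a partition when all its parts are positive. -/
def IsPartition (m : Multiset ℕ) : Prop := 0 ∉ m

/-- A strict partition: positive, pairwise distinct parts. -/
def IsStrictPartition (m : Multiset ℕ) : Prop := 0 ∉ m ∧ m.Nodup

/-- The first (largest) part `λ₁` of a partition. -/
def firstPart (m : Multiset ℕ) : ℕ := m.sup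

/-- The size `|λ|` of a partition. -/
def psize (m : Multiset ℕ) : ℕ := m.sum

/-- The conjugate (transposed) partition. -/
def conj (m : Multiset ℕ) : Multiset ℕ :=
  ((List.range m.sup).map fun i => Multiset.card (m.filter fun x => i < x) : List ℕ)

/-- The partition `ν[N] = (N - |ν|, ν₁, ν₂, …)` (valid when `N ≥ |ν| + ν₁`). -/
def padded (ν : Multiset ℕ) (N : ℕ) : Multiset ℕ := (N - ν.sum) ::ₘ ν

/-- `c` is the expansion of `f` in the basis of Schur functions indexed by partitions. -/
def SchurExpansion (f : SymFn) (c : Multiset ℕ →₀ ℚ) : Prop :=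
  (∀ κ ∈ c.support, IsPartition κ) ∧ f = c.sum fun κ a => a • schur κ

/-- `Φ` of a Schur expansion: the largest first part of a partition occurring in it. -/
def Phi (c : Multiset ℕ →₀ ℚ) : ℕ := c.support.sup firstPart

/-- The partition `2α`, doubling every part. -/
def double (m : Multiset ℕ) : Multiset ℕ := m.map (2 * ·)

/-- For a strict partition `β = (β₁ > β₂ > … > β_r > 0)`, the partition `Γ(β)` with
Frobenius coordinates `(β₁ - 1, …, β_r - 1 | β₁, …, β_r)`. -/
def gammaFrob (β : Multiset ℕ) : Multiset ℕ :=
  let b := sortedParts β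
  let r := b.length
  (((List.range r).map fun i => b.getD i 0 + i)
    ++ ((List.range (b.getD 0 0 + 1 - r)).map fun t =>
        ((List.range r).filter fun j => r + t ≤ b.getD j 0 + j).length) : List ℕ)


/-! ### Part 1: evaluation of symmetric functions at a finite family -/

section Eval

set_option linter.unusedSectionVars false

variable {R : Type*} [CommRing R] [Algebra ℚ R] {ι : Type*}

/-- generating series of complete symmetric functions of the family `x` over `s` -/
noncomputable def Hser (s : Finset ι) (x : ι → R) : PowerSeries R :=
  ∏ i ∈ s, PowerSeries.mk fun n => x i ^ n

/-- generating series of elementary symmetric functions of the family `x` over `s` -/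
noncomputable def Eser (s : Finset ι) (x : ι → R) : PowerSeries R :=
  ∏ i ∈ s, (1 + PowerSeries.C (x i) * PowerSeries.X)

/-- generating series of signed elementary symmetric functions -/
noncomputable def Dser (s : Finset ι) (x : ι → R) : PowerSeries R :=
  ∏ i ∈ s, (1 - PowerSeries.C (x i) * PowerSeries.X)

theorem geom_mul (a : R) :
    (PowerSeries.mk fun n => a ^ n) * (1 - PowerSeries.C a * PowerSeries.X) = 1 := by
  ext n
  rw [mul_sub, mul_one, mul_comm (PowerSeries.C a), ← mul_assoc]
  cases n with
  | zero => simp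
  | succ n =>
    simp [PowerSeries.coeff_succ_mul_X, PowerSeries.coeff_mul_C, PowerSeries.coeff_one, pow_succ]

theorem Hser_mul_Dser (s : Finset ι) (x : ι → R) : Hser s x * Dser s x = 1 := by
  rw [Hser, Dser, ← Finset.prod_mul_distrib]
  exact Finset.prod_eq_one fun i _ => geom_mul _

theorem coeff_Eser (s : Finset ι) (x : ι → R) (k : ℕ) :
    PowerSeries.coeff k (Eser s x) = ∑ t ∈ s.powersetCard k, ∏ i ∈ t, x i := by
  classical
  rw [Eser, Finset.prod_one_add, map_sum]
  have : ∀ t : Finset ι, PowerSeries.coeff k (∏ i ∈ t, (PowerSeries.C (x i) * PowerSeries.X))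
      = if t.card = k then ∏ i ∈ t, x i else 0 := by
    intro t
    rw [Finset.prod_mul_distrib, Finset.prod_const, ← map_prod, PowerSeries.coeff_C_mul,
      PowerSeries.coeff_X_pow]
    simp [eq_comm]
  simp_rw [this]
  rw [← Finset.sum_filter]
  refine Finset.sum_congr ?_ fun _ _ => rfl
  ext t
  simp [Finset.mem_powersetCard]

theorem coeff_Dser (s : Finset ι) (x : ι → R) (k : ℕ) :
    PowerSeries.coeff k (Dser s x) = (-1) ^ k * PowerSeries.coeff k (Eser s x) := by
  have h : Dser s x = Eser s (fun i => - x i) := by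
    simp [Dser, Eser, sub_eq_add_neg]
  rw [h, coeff_Eser, coeff_Eser, Finset.mul_sum]
  refine Finset.sum_congr rfl fun t ht => ?_
  rw [Finset.prod_neg, (Finset.mem_powersetCard.1 ht).2]

theorem deriv_Hser (s : Finset ι) (x : ι → R) :
    PowerSeries.derivative R (Hser s x)
      = Hser s x * PowerSeries.mk (fun n => ∑ i ∈ s, x i ^ (n + 1)) := by
  classical
  have hg : ∀ a : R, PowerSeries.derivative R (PowerSeries.mk fun n => a ^ n)
      = (PowerSeries.mk fun n => a ^ n) * PowerSeries.mk (fun n => a ^ (n + 1)) := by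
    intro a
    ext n
    rw [PowerSeries.coeff_derivative, PowerSeries.coeff_mul]
    simp only [PowerSeries.coeff_mk]
    rw [Finset.sum_congr rfl (g := fun _ => a ^ (n + 1))]
    · simp [mul_comm]
    · intro p hp
      rw [← pow_add, ← add_assoc, Finset.HasAntidiagonal.mem_antidiagonal.1 hp]
  induction s using Finset.induction_on with
  | empty =>
    ext n
    simp [Hser]
  | insert a s ha ih =>
    have e1 : Hser (insert a s) x = (PowerSeries.mk fun n => x a ^ n) * Hser s x := by
      rw [Hser, Finset.prod_insert ha, Hser]
    have e2 : (PowerSeries.mk fun n => ∑ i ∈ insert a s, x i ^ (n + 1))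
        = PowerSeries.mk (fun n => x a ^ (n + 1))
          + PowerSeries.mk (fun n => ∑ i ∈ s, x i ^ (n + 1)) := by
      ext n
      simp [Finset.sum_insert ha]
    rw [e1, e2, Derivation.leibniz, ih, hg]
    simp only [smul_eq_mul]
    ring

theorem coeff_zero_Hser (s : Finset ι) (x : ι → R) :
    PowerSeries.coeff 0 (Hser s x) = 1 := by
  simp [Hser, ← PowerSeries.coeff_zero_eq_constantCoeff_apply, map_prod]

/-- Newton's identity. -/
theorem newton_Hser (s : Finset ι) (x : ι → R) (m : ℕ) :
    ((m : ℚ) + 1) • PowerSeries.coeff (m + 1) (Hser s x)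
      = ∑ i ∈ Finset.range (m + 1), (∑ l ∈ s, x l ^ (i + 1)) *
          PowerSeries.coeff (m - i) (Hser s x) := by
  have h := congrArg (PowerSeries.coeff m) (deriv_Hser s x)
  rw [PowerSeries.coeff_derivative, mul_comm (Hser s x), PowerSeries.coeff_mul,
    Finset.Nat.sum_antidiagonal_eq_sum_range_succ_mk] at h
  simp only [PowerSeries.coeff_mk] at h
  rw [← h, Algebra.smul_def]
  simp [mul_comm]

/-- evaluation homomorphism -/
noncomputable def ev (s : Finset ι) (x : ι → R) : SymFn →ₐ[ℚ] R :=
  aeval fun m => PowerSeries.coeff (m + 1) (Hser s x)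

theorem hh_natCast_succ (n : ℕ) : hh ((n : ℤ) + 1) = X n := by
  rw [hh, if_neg (by omega), if_neg (by omega)]
  congr 1

theorem hh_zero : hh 0 = 1 := by simp [hh]

theorem ev_hh (s : Finset ι) (x : ι → R) (n : ℕ) :
    ev s x (hh n) = PowerSeries.coeff n (Hser s x) := by
  cases n with
  | zero => rw [Nat.cast_zero, hh_zero, map_one, coeff_zero_Hser]
  | succ n =>
    rw [Nat.cast_succ, hh_natCast_succ, ev, aeval_X]

theorem ev_hh_neg (s : Finset ι) (x : ι → R) (n : ℤ) (hn : n < 0) :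
    ev s x (hh n) = 0 := by
  rw [hh, if_pos hn, map_zero]

theorem ev_pp (s : Finset ι) (x : ι → R) (m : ℕ) :
    ev s x (pp (m + 1)) = ∑ i ∈ s, x i ^ (m + 1) := by
  induction m using Nat.strong_induction_on with
  | _ m ih =>
    rw [pp, map_sub, map_smul, map_sum]
    have h := newton_Hser s x m
    have e0 : ev s x (hh ((m : ℤ) + 1)) = PowerSeries.coeff (m + 1) (Hser s x) := by
      have := ev_hh s x (m + 1)
      rwa [Nat.cast_succ] at this
    rw [e0, h, Finset.sum_range_succ, Nat.sub_self, coeff_zero_Hser, mul_one, add_sub_assoc,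
      add_comm, sub_add_eq_add_sub, sub_eq_iff_eq_add, add_right_inj]
    rw [← Finset.sum_range_reflect]
    refine Finset.sum_congr rfl fun i hi => ?_
    have hi' := Finset.mem_range.1 hi
    have e1 : ev s x (hh ((i : ℤ) + 1)) = PowerSeries.coeff (i + 1) (Hser s x) := by
      have := ev_hh s x (i + 1)
      rwa [Nat.cast_succ] at this
    obtain ⟨d, rfl⟩ : ∃ d, m = i + 1 + d := ⟨m - i - 1, by omega⟩
    rw [map_mul, e1, show i + 1 + d - i = d + 1 by omega, ih d (by omega), mul_comm]
    rw [show i + 1 + d - 1 - i = d by omega, show i + 1 + d - d = i + 1 by omega]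

theorem aeval_hInP (s : Finset ι) (x : ι → R) (m : ℕ) :
    aeval (fun j => ∑ i ∈ s, x i ^ (j + 1)) (hInP m) = PowerSeries.coeff m (Hser s x) := by
  induction m using Nat.strong_induction_on with
  | _ m ih =>
    cases m with
    | zero => rw [hInP, map_one, coeff_zero_Hser]
    | succ m =>
      have hm : ((m : ℚ) + 1) ≠ 0 := by positivity
      rw [hInP, map_smul, inv_smul_eq_iff₀ hm, newton_Hser, map_sum]
      refine Finset.sum_congr rfl fun i hi => ?_
      rw [map_mul, aeval_X, ih _ (by omega)]

theorem ev_adams (s : Finset ι) (x : ι → R) (k : ℕ) (f : SymFn) :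
    ev s x (adams (k + 1) f) = ev s (fun i => x i ^ (k + 1)) f := by
  have : (ev s x).comp (adams (k + 1)) = ev s (fun i => x i ^ (k + 1)) := by
    apply MvPolynomial.algHom_ext
    intro m
    rw [AlgHom.comp_apply, adams, aeval_X, ev, ev, aeval_X, ← ev, ← AlgHom.comp_apply,
      comp_aeval, ← aeval_hInP]
    congr 2
    funext j
    have : (k + 1) * (j + 1) = (k * (j + 1) + j) + 1 := by ring
    rw [this, ev_pp, ← this]
    simp_rw [pow_mul]
  rw [← this, AlgHom.comp_apply]

theorem ev_ee (s : Finset ι) (x : ι → R) (m : ℕ) :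
    ev s x (ee m) = PowerSeries.coeff m (Eser s x) := by
  induction m using Nat.strong_induction_on with
  | _ m ih =>
    cases m with
    | zero => rw [ee, map_one, coeff_Eser]; simp
    | succ m =>
      rw [ee, map_sum]
      have h := congrArg (PowerSeries.coeff (m + 1)) (Hser_mul_Dser s x)
      rw [PowerSeries.coeff_mul, Finset.Nat.sum_antidiagonal_eq_sum_range_succ_mk,
        Finset.sum_range_succ', PowerSeries.coeff_one, if_neg (by omega)] at h
      simp only [coeff_zero_Hser, one_mul, Nat.sub_zero, coeff_Dser] at h
      have h1 : ∀ i ∈ Finset.range (m + 1), ev s x ((-1 : ℚ) ^ i • (hh (i + 1) * ee (m - i)))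
          = (-1) ^ m * (PowerSeries.coeff (i + 1) (Hser s x) * ((-1) ^ (m + 1 - (i + 1)) *
            PowerSeries.coeff (m + 1 - (i + 1)) (Eser s x))) := by
        intro i hi
        have hi' := Finset.mem_range.1 hi
        have e1 : ev s x (hh ((i : ℤ) + 1)) = PowerSeries.coeff (i + 1) (Hser s x) := by
          have := ev_hh s x (i + 1)
          rwa [Nat.cast_succ] at this
        rw [map_smul, map_mul, e1, ih _ (by omega), Algebra.smul_def]
        simp only [map_pow, map_neg, map_one]
        obtain ⟨d, rfl⟩ : ∃ d, m = i + d := ⟨m - i, by omega⟩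
        have e2 : i + d + 1 - (i + 1) = d := by omega
        have e3 : i + d - i = d := by omega
        rw [e2, e3, pow_add]
        have : ((-1 : R) ^ d) * (-1) ^ d = 1 := by rw [← mul_pow]; simp
        linear_combination (-(-1) ^ i * PowerSeries.coeff (i + 1) (Hser s x)
          * PowerSeries.coeff d (Eser s x)) * this
      rw [Finset.sum_congr rfl h1, ← Finset.mul_sum, eq_neg_of_add_eq_zero_left h, pow_succ]
      have : ((-1 : R) ^ m) * (-1) ^ m = 1 := by rw [← mul_pow]; simp
      linear_combination (PowerSeries.coeff (m + 1) (Eser s x)) * this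

theorem ev_hPleth (s : Finset ι) (x : ι → R) (m : ℕ) :
    ev s x (hPleth (ee 2) m)
      = PowerSeries.coeff m (Hser (s.powersetCard 2) (fun t => ∏ i ∈ t, x i)) := by
  induction m using Nat.strong_induction_on with
  | _ m ih =>
    cases m with
    | zero => rw [hPleth, map_one, coeff_zero_Hser]
    | succ m =>
      have hm : ((m : ℚ) + 1) ≠ 0 := by positivity
      rw [hPleth, map_smul, inv_smul_eq_iff₀ hm, newton_Hser, map_sum]
      refine Finset.sum_congr rfl fun i hi => ?_
      rw [map_mul, ih _ (by omega), ev_adams, ev_ee, coeff_Eser]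
      simp_rw [Finset.prod_pow]

theorem ev_pleth (s : Finset ι) (x : ι → R) (f : SymFn) :
    ev s x (pleth f (ee 2)) = ev (s.powersetCard 2) (fun t => ∏ i ∈ t, x i) f := by
  rw [pleth, ← AlgHom.comp_apply, comp_aeval]
  simp_rw [ev_hPleth]
  rfl

theorem ev_pleth_ee (s : Finset ι) (x : ι → R) (k : ℕ) :
    ev s x (pleth (ee k) (ee 2))
      = PowerSeries.coeff k (Eser (s.powersetCard 2) (fun t => ∏ i ∈ t, x i)) := by
  rw [ev_pleth, ev_ee]

end Eval

/-! ### Part 2: joint injectivity -/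

theorem ee_surj : Function.Surjective (aeval (fun m => ee (m + 1)) : SymFn →ₐ[ℚ] SymFn) := by
  set ω : SymFn →ₐ[ℚ] SymFn := aeval (fun m => ee (m + 1)) with hω
  have hX : ∀ m : ℕ, (X m : SymFn) ∈ ω.range := by
    intro m
    have hee : ∀ k, ee k ∈ ω.range := by
      intro k
      cases k with
      | zero => rw [ee]; exact one_mem _
      | succ k => exact ⟨X k, by simp [hω]⟩
    induction m using Nat.strong_induction_on with
    | _ m ih =>
      have h : ee (m + 1) = ∑ i ∈ Finset.range m, ((-1 : ℚ)) ^ i • (hh (i + 1) * ee (m - i))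
          + (-1 : ℚ) ^ m • X m := by
        rw [ee, Finset.sum_range_succ, Nat.sub_self, hh_natCast_succ, ee, mul_one]
      have h2 : (X m : SymFn) = (-1 : ℚ) ^ m • (ee (m + 1) -
          ∑ i ∈ Finset.range m, ((-1 : ℚ)) ^ i • (hh (i + 1) * ee (m - i))) := by
        rw [h, add_sub_cancel_left, smul_smul, ← mul_pow]
        simp
      rw [h2]
      refine Subalgebra.smul_mem _ (sub_mem (hee _) (sum_mem fun i hi => ?_)) _
      refine Subalgebra.smul_mem _ (mul_mem ?_ (hee _)) _
      rw [hh_natCast_succ]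
      exact ih i (Finset.mem_range.1 hi)
  have : ω.range = ⊤ := by
    rw [eq_top_iff, ← MvPolynomial.adjoin_range_X]
    refine Algebra.adjoin_le ?_
    rintro _ ⟨m, rfl⟩
    exact hX m
  exact (AlgHom.range_eq_top ω).1 this

theorem symfn_inj (f : SymFn) (k : ℕ)
    (h : ∀ N, k < N → ev (Finset.univ : Finset (Fin N))
      (fun i => algebraMap (MvPolynomial (Fin N) ℚ) (FractionRing (MvPolynomial (Fin N) ℚ)) (X i)) f
        = 0) : f = 0 := by
  obtain ⟨g, rfl⟩ := ee_surj f
  obtain ⟨N, hkN, hN⟩ : ∃ N, k < N ∧ ∀ v ∈ g.vars, v < N := by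
    refine ⟨k + 1 + g.vars.sup id + 1, by omega, fun v hv => ?_⟩
    have : v ≤ g.vars.sup id := Finset.le_sup (f := id) hv
    omega
  have h0 := h N hkN
  obtain ⟨g', rfl⟩ := exists_rename_eq_of_vars_subset_range g (Fin.val : Fin N → ℕ)
    Fin.val_injective (by
      intro v hv
      exact ⟨⟨v, hN v hv⟩, rfl⟩)
  have key : aeval (fun i : Fin N => esymm (Fin N) ℚ (i + 1)) g' = 0 := by
    apply IsFractionRing.injective (MvPolynomial (Fin N) ℚ) (FractionRing (MvPolynomial (Fin N) ℚ))
    rw [map_zero, ← h0, aeval_rename, ← AlgHom.comp_apply, comp_aeval, ← IsScalarTower.coe_toAlgHom' ℚ,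
      ← AlgHom.comp_apply, comp_aeval]
    congr 2
    funext i
    simp only [Function.comp]
    rw [ev_ee, coeff_Eser, esymm]
    simp
  have inj := esymmAlgHom_injective (σ := Fin N) (n := N) ℚ (by simp)
  have : g' = 0 := by
    apply inj
    rw [map_zero]
    apply Subtype.ext
    rw [esymmAlgHom_apply, key]
    rfl
  rw [this]
  simp

/-! ### Part 3: the determinant evaluation -/

section Dets

variable {K : Type*} [Field K] [Algebra ℚ K]

theorem sum_coeff_ev {n : ℕ} (x : Fin (n + 1) → K) (k : Fin (n + 1)) (a : ℕ) :
    ∑ i : Fin (n + 1), PowerSeries.coeff (n - i) (Dser (Finset.univ.erase k) x) *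
      ev Finset.univ x (hh ((i : ℤ) + ((a : ℤ) - n))) = x k ^ a := by
  have hprod : Dser (Finset.univ.erase k) x * Hser Finset.univ x
      = PowerSeries.mk fun m => x k ^ m := by
    have h1 : Hser Finset.univ x = (PowerSeries.mk fun m => x k ^ m) *
        Hser (Finset.univ.erase k) x := by
      exact (Finset.mul_prod_erase _ (fun i => PowerSeries.mk fun m => x i ^ m)
        (Finset.mem_univ k)).symm
    have h2 := Hser_mul_Dser (Finset.univ.erase k) x
    rw [h1]
    linear_combination (PowerSeries.mk fun m => x k ^ m) * h2
  have hc := congrArg (PowerSeries.coeff a) hprod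
  rw [PowerSeries.coeff_mul, Finset.Nat.sum_antidiagonal_eq_sum_range_succ_mk,
    PowerSeries.coeff_mk] at hc
  rw [← hc]
  have hD : ∀ p, n < p → PowerSeries.coeff p (Dser (Finset.univ.erase k) x) = 0 := by
    intro p hp
    rw [coeff_Dser, coeff_Eser, Finset.powersetCard_eq_empty.2, Finset.sum_empty, mul_zero]
    rw [Finset.card_erase_of_mem (Finset.mem_univ k)]
    simpa using hp
  have e1 : ∑ p ∈ Finset.range (a + 1), PowerSeries.coeff p (Dser (Finset.univ.erase k) x) *
      PowerSeries.coeff (a - p) (Hser Finset.univ x)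
      = ∑ p ∈ Finset.range (n + 1 + a), PowerSeries.coeff p (Dser (Finset.univ.erase k) x) *
        ev Finset.univ x (hh ((a : ℤ) - p)) := by
    have : ∑ p ∈ Finset.range (a + 1), PowerSeries.coeff p (Dser (Finset.univ.erase k) x) *
      PowerSeries.coeff (a - p) (Hser Finset.univ x) = ∑ p ∈ Finset.range (a + 1),
        PowerSeries.coeff p (Dser (Finset.univ.erase k) x) *
        ev Finset.univ x (hh ((a : ℤ) - p)) := by
      refine Finset.sum_congr rfl fun p hp => ?_
      have := Finset.mem_range.1 hp
      rw [← ev_hh, Nat.cast_sub (by omega)]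
    rw [this]
    refine Finset.sum_subset ?_ ?_
    · intro p hp
      simp only [Finset.mem_range] at hp ⊢
      omega
    · intro p _ hp
      rw [ev_hh_neg, mul_zero]
      simp only [Finset.mem_range] at hp
      omega
  have e2 : ∑ p ∈ Finset.range (n + 1), PowerSeries.coeff p (Dser (Finset.univ.erase k) x) *
        ev Finset.univ x (hh ((a : ℤ) - p))
      = ∑ p ∈ Finset.range (n + 1 + a), PowerSeries.coeff p (Dser (Finset.univ.erase k) x) *
        ev Finset.univ x (hh ((a : ℤ) - p)) := by
    refine Finset.sum_subset ?_ ?_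
    · intro p hp
      simp only [Finset.mem_range] at hp ⊢
      omega
    · intro p _ hp
      rw [hD, zero_mul]
      simp only [Finset.mem_range] at hp
      omega
  simp only at hc ⊢
  rw [e1, ← e2, ← Finset.sum_range_reflect, Fin.sum_univ_eq_sum_range (fun i =>
    PowerSeries.coeff (n - i) (Dser (Finset.univ.erase k) x) *
      ev Finset.univ x (hh ((i : ℤ) + ((a : ℤ) - n)))) (n + 1)]
  refine Finset.sum_congr rfl fun p hp => ?_
  have hp' := Finset.mem_range.1 hp
  rw [show n + 1 - 1 - p = n - p by omega]
  congr 3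
  rw [Nat.cast_sub (by omega)]
  ring

/-- the monic polynomials `P_b` -/
noncomputable def dick {R : Type*} [CommRing R] (q : R) (b : ℕ) : Polynomial R :=
  if b = 0 then 1 else Polynomial.dickson 1 q b

theorem dickson_deg {R : Type*} [CommRing R] [Nontrivial R] (q : R) (b : ℕ) :
    (Polynomial.dickson 1 q (b + 1)).Monic ∧
      (Polynomial.dickson 1 q (b + 1)).natDegree = b + 1 := by
  induction b using Nat.strong_induction_on with
  | _ b ih =>
    rcases b with _ | _ | b
    · simp [Polynomial.monic_X]
    · have h : Polynomial.dickson 1 q (0 + 1 + 1)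
          = Polynomial.X ^ 2 - Polynomial.C (q * 2) := by
        rw [Polynomial.dickson_two]
        simp only [map_mul, Polynomial.C_ofNat]
        norm_num
      rw [h]
      exact ⟨Polynomial.monic_X_pow_sub_C _ (by norm_num), Polynomial.natDegree_X_pow_sub_C⟩
    · obtain ⟨m1, d1⟩ := ih (b + 1) (by omega)
      obtain ⟨m0, d0⟩ := ih b (by omega)
      rw [show b + 1 + 1 + 1 = (b + 1) + 2 by ring, Polynomial.dickson_add_two]
      have hm : (Polynomial.X * Polynomial.dickson 1 q (b + 1 + 1)).Monic :=
        Polynomial.monic_X.mul m1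
      have hd : (Polynomial.X * Polynomial.dickson 1 q (b + 1 + 1)).natDegree = b + 3 := by
        rw [Polynomial.natDegree_X_mul m1.ne_zero, d1]
      have hlt : (Polynomial.C q * Polynomial.dickson 1 q (b + 1)).degree <
          (Polynomial.X * Polynomial.dickson 1 q (b + 1 + 1)).degree := by
        refine Polynomial.degree_lt_degree ?_
        rw [hd]
        exact lt_of_le_of_lt (Polynomial.natDegree_C_mul_le _ _) (by omega)
      refine ⟨hm.sub_of_left hlt, ?_⟩
      rw [Polynomial.natDegree_sub_eq_left_of_natDegree_lt, hd]
      rw [hd]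
      exact lt_of_le_of_lt (Polynomial.natDegree_C_mul_le _ _) (by omega)

theorem dickson_ev {R : Type*} [CommRing R] (q y z : R) (h : y * z = 1) (b : ℕ) :
    (Polynomial.dickson 1 q b).eval (z + q * y) = z ^ b + q ^ b * y ^ b := by
  induction b using Nat.strong_induction_on with
  | _ b ih =>
    rcases b with _ | _ | b
    · simp; norm_num
    · simp
    · rw [Polynomial.dickson_add_two]
      simp only [Polynomial.eval_sub, Polynomial.eval_mul, Polynomial.eval_X, Polynomial.eval_C]
      rw [ih (b + 1) (by omega), ih b (by omega)]
      linear_combination (q * z ^ b + q ^ (b + 1) * y ^ b) * h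

/-- the matrix with rows `h_{i-b} + q^b h_{i+b}` (and `h_i` for `b = 0`) -/
noncomputable def Amat {n : ℕ} (x : Fin (n + 1) → K) (q : Polynomial K) :
    Matrix (Fin (n + 1)) (Fin (n + 1)) (Polynomial K) :=
  Matrix.of fun b i => Polynomial.C (ev Finset.univ x (hh ((i : ℤ) + (-(b : ℤ)))))
    + if (b : ℕ) = 0 then 0 else
      q ^ (b : ℕ) * Polynomial.C (ev Finset.univ x (hh ((i : ℤ) + b)))

theorem det_Amat {n : ℕ} (x : Fin (n + 1) → K) (hx : Function.Injective x) (h0 : ∀ i, x i ≠ 0)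
    (q : Polynomial K) :
    (Amat x q).det = ∏ i, ∏ j ∈ Finset.Ioi i, (1 - q * Polynomial.C (x i * x j)) := by
  set M : Matrix (Fin (n + 1)) (Fin (n + 1)) (Polynomial K) := Matrix.of fun i k =>
    Polynomial.C (PowerSeries.coeff (n - i) (Dser (Finset.univ.erase k) x)) with hM
  set L : Matrix (Fin (n + 1)) (Fin (n + 1)) (Polynomial K) := Matrix.of fun b i =>
    Polynomial.C (ev Finset.univ x (hh ((i : ℤ) + (-(b : ℤ))))) with hL
  set Dg : Polynomial K := ∏ k, Polynomial.C (x k) ^ n with hDg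
  have hsum : ∀ (k : Fin (n + 1)) (a : ℕ), ∑ i : Fin (n + 1),
      Polynomial.C (ev Finset.univ x (hh ((i : ℤ) + ((a : ℤ) - n)))) * M i k
        = Polynomial.C (x k) ^ a := by
    intro k a
    rw [← map_pow, ← sum_coeff_ev x k a, map_sum]
    refine Finset.sum_congr rfl fun i _ => ?_
    rw [map_mul, mul_comm]
    rfl
  have hxi : ∀ k, Polynomial.C (x k) * Polynomial.C (x k)⁻¹ = 1 := by
    intro k
    rw [← map_mul, mul_inv_cancel₀ (h0 k), map_one]
  have hLdet : L.det = 1 := by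
    rw [Matrix.det_of_isUpperTriangular]
    · refine Finset.prod_eq_one fun i _ => ?_
      simp [hL, hh_zero]
    · intro i j hij
      have hij' : j < i := hij
      simp only [hL, Matrix.of_apply]
      rw [ev_hh_neg, map_zero]
      have : (j : ℕ) < i := hij'
      omega
  have hLM : (L * M).transpose = Matrix.of fun k b : Fin (n + 1) =>
      Polynomial.C (x k) ^ n * (Matrix.vandermonde fun k => Polynomial.C (x k)⁻¹) k b := by
    ext1 k b
    have hb : (b : ℕ) ≤ n := Nat.lt_succ_iff.1 b.2
    rw [Matrix.transpose_apply, Matrix.mul_apply]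
    have := hsum k (n - b)
    rw [Nat.cast_sub hb, show (n : ℤ) - b - n = -b by ring] at this
    simp only [hL, Matrix.of_apply, Matrix.vandermonde_apply]
    rw [this]
    obtain ⟨d, hd⟩ : ∃ d, n = d + b := ⟨n - b, by omega⟩
    have h1 : Polynomial.C (x k) ^ (b : ℕ) * Polynomial.C (x k)⁻¹ ^ (b : ℕ) = 1 := by
      rw [← mul_pow, hxi, one_pow]
    have h2 : n - (b : ℕ) = d := by omega
    rw [h2]
    have h3 : Polynomial.C (x k) ^ n = Polynomial.C (x k) ^ d * Polynomial.C (x k) ^ (b : ℕ) := by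
      rw [← pow_add, ← hd]
    rw [h3, mul_assoc, h1, mul_one]
  have hAM : (Amat x q * M).transpose = Matrix.of fun k b : Fin (n + 1) =>
      Polynomial.C (x k) ^ n * (Matrix.of fun k b : Fin (n + 1) => (dick q (b : ℕ)).eval
        (Polynomial.C (x k)⁻¹ + q * Polynomial.C (x k))) k b := by
    ext1 k b
    have hb : (b : ℕ) ≤ n := Nat.lt_succ_iff.1 b.2
    rw [Matrix.transpose_apply, Matrix.mul_apply]
    have e1 := hsum k (n - b)
    have e2 := hsum k (n + b)
    rw [Nat.cast_sub hb, show (n : ℤ) - b - n = -b by ring] at e1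
    rw [Nat.cast_add, show (n : ℤ) + b - n = b by ring] at e2
    simp only [Amat, Matrix.of_apply, add_mul, Finset.sum_add_distrib]
    rw [e1]
    obtain ⟨d, hd⟩ : ∃ d, n = d + b := ⟨n - b, by omega⟩
    have h1 : Polynomial.C (x k) ^ (b : ℕ) * Polynomial.C (x k)⁻¹ ^ (b : ℕ) = 1 := by
      rw [← mul_pow, hxi, one_pow]
    have h2 : n - (b : ℕ) = d := by omega
    rw [h2]
    by_cases hb0 : (b : ℕ) = 0
    · have : d = n := by omega
      simp [hb0, dick, this]
    · simp only [hb0, if_false, dick, mul_assoc, ← Finset.mul_sum]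
      rw [e2, dickson_ev q _ _ (hxi k)]
      have h3 : Polynomial.C (x k) ^ n = Polynomial.C (x k) ^ d * Polynomial.C (x k) ^ (b : ℕ) := by
        rw [← pow_add, ← hd]
      rw [pow_add, h3]
      linear_combination (-Polynomial.C (x k) ^ d) * h1
  have d1 : M.det = Dg * ∏ i, ∏ j ∈ Finset.Ioi i,
      (Polynomial.C (x j)⁻¹ - Polynomial.C (x i)⁻¹) := by
    have := congrArg Matrix.det hLM
    rwa [Matrix.det_transpose, Matrix.det_mul, hLdet, one_mul, Matrix.det_mul_column,
      Matrix.det_vandermonde] at this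
  have d2 : (Amat x q).det * M.det = Dg * ∏ i, ∏ j ∈ Finset.Ioi i,
      ((Polynomial.C (x j)⁻¹ + q * Polynomial.C (x j)) -
        (Polynomial.C (x i)⁻¹ + q * Polynomial.C (x i))) := by
    have := congrArg Matrix.det hAM
    rw [Matrix.det_transpose, Matrix.det_mul, Matrix.det_mul_column] at this
    rw [this, ← Matrix.det_eval_matrixOfPolynomials_eq_det_vandermonde, Matrix.det_vandermonde]
    · intro i
      rw [dick]
      split_ifs with h
      · simp [h]
      · obtain ⟨c, hc⟩ := Nat.exists_eq_succ_of_ne_zero h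
        rw [hc]
        exact (dickson_deg q c).2
    · intro i
      rw [dick]
      split_ifs with h
      · exact Polynomial.monic_one
      · obtain ⟨c, hc⟩ := Nat.exists_eq_succ_of_ne_zero h
        rw [hc]
        exact (dickson_deg q c).1
  have hM0 : M.det ≠ 0 := by
    rw [d1]
    refine mul_ne_zero (Finset.prod_ne_zero_iff.2 fun i _ => pow_ne_zero _ ?_)
      (Finset.prod_ne_zero_iff.2 fun i _ => Finset.prod_ne_zero_iff.2 fun j hj => ?_)
    · simpa using h0 i
    · rw [← map_sub, Ne, Polynomial.C_eq_zero, sub_eq_zero]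
      intro h
      have : j = i := hx (inv_injective h)
      rw [this] at hj
      simp at hj
  clear_value Dg
  apply mul_right_cancel₀ hM0
  rw [d2, d1, mul_left_comm, ← Finset.prod_mul_distrib]
  congr 1
  refine Finset.prod_congr rfl fun i _ => ?_
  rw [← Finset.prod_mul_distrib]
  refine Finset.prod_congr rfl fun j _ => ?_
  rw [map_mul]
  linear_combination (-q * Polynomial.C (x j)) * hxi i + (q * Polynomial.C (x i)) * hxi j

end Dets

/-! ### Part 4: combinatorics of the partitions `Γ(β)` -/

section Comb

/-- number of `j < r` with `i ≤ B j + j` -/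
def cnt (B : ℕ → ℕ) (r i : ℕ) : ℕ :=
  ((List.range r).filter fun j => i ≤ B j + j).length

/-- the `i`-th part of `Γ(β)` -/
def lam (B : ℕ → ℕ) (r i : ℕ) : ℕ := if i < r then B i + i else cnt B r i

theorem cnt_spec (B : ℕ → ℕ) (r i : ℕ) (hB : ∀ a b, a ≤ b → b < r → B b + b ≤ B a + a) :
    cnt B r i ≤ r ∧ ∀ j < r, (j < cnt B r i ↔ i ≤ B j + j) := by
  classical
  have hex : ∃ j, j = r ∨ ¬ (i ≤ B j + j) := ⟨r, Or.inl rfl⟩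
  set c := Nat.find hex with hc
  have hcr : c ≤ r := Nat.find_min' hex (Or.inl rfl)
  have hj : ∀ j < r, (j < c ↔ i ≤ B j + j) := by
    intro j hjr
    constructor
    · intro hjc
      have := Nat.find_min hex hjc
      push Not at this
      exact this.2
    · intro h
      by_contra hcon
      push Not at hcon
      rcases Nat.find_spec hex with h1 | h1
      · omega
      · have := hB c j hcon hjr
        rw [← hc] at h1
        omega
  have hcnt : cnt B r i = c := by
    have : cnt B r i = ((Finset.range r).filter fun j => i ≤ B j + j).card := rfl
    rw [this]
    have h2 : ((Finset.range r).filter fun j => i ≤ B j + j) = Finset.range c := by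
      ext j
      simp only [Finset.mem_filter, Finset.mem_range]
      constructor
      · rintro ⟨h1, h2⟩
        exact (hj j h1).2 h2
      · intro h
        exact ⟨by omega, (hj j (by omega)).1 h⟩
    rw [h2, Finset.card_range]
  rw [hcnt]
  exact ⟨hcr, hj⟩

theorem B_mono (B : ℕ → ℕ) (r : ℕ) (hs : ∀ a b, a < b → b < r → B b < B a) :
    ∀ a b, a ≤ b → b < r → B b + b ≤ B a + a := by
  intro a b hab
  induction b, hab using Nat.le_induction with
  | base => intro _; exact le_rfl
  | succ b hab ih =>
    intro hb
    have h1 := ih (by omega)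
    have h2 := hs b (b + 1) (by omega) hb
    omega

theorem lam_anti (B : ℕ → ℕ) (r : ℕ) (hs : ∀ a b, a < b → b < r → B b < B a)
    (hp : ∀ a < r, 0 < B a) : ∀ i j, i ≤ j → lam B r j ≤ lam B r i := by
  intro i j hij
  have hB := B_mono B r hs
  rw [lam, lam]
  split_ifs with h1 h2 h2
  · exact hB i j hij h1
  · omega
  · have h3 := (cnt_spec B r j hB).1
    have h4 := hB i (r - 1) (by omega) (by omega)
    have h5 := hp (r - 1) (by omega)
    omega
  · obtain ⟨a1, a2⟩ := cnt_spec B r i hB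
    obtain ⟨b1, b2⟩ := cnt_spec B r j hB
    by_contra hcon
    push Not at hcon
    have h3 := (b2 (cnt B r i) (by omega)).1 hcon
    have h4 := (a2 (cnt B r i) (by omega)).2 (by omega)
    omega

theorem lam_zero (B : ℕ → ℕ) (r : ℕ) (hs : ∀ a b, a < b → b < r → B b < B a)
    (i : ℕ) (hi : r ≤ i) (h0 : B 0 < i ∨ r = 0) : lam B r i = 0 := by
  have hB := B_mono B r hs
  rw [lam, if_neg (by omega)]
  obtain ⟨a1, a2⟩ := cnt_spec B r i hB
  by_contra hcon
  have hr : 0 < r := by omega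
  have := (a2 0 hr).1 (by omega)
  omega

theorem det_pad (l : ℕ → ℕ) (m N : ℕ) (hmN : m ≤ N) (hl : ∀ i, m ≤ i → l i = 0) :
    Matrix.det (Matrix.of fun i j : Fin N => hh ((l i : ℤ) + (j : ℤ) - (i : ℤ)))
      = Matrix.det (Matrix.of fun i j : Fin m => hh ((l i : ℤ) + (j : ℤ) - (i : ℤ))) := by
  induction N, hmN using Nat.le_induction with
  | base => rfl
  | succ N hmN ih =>
    rw [← ih, Matrix.det_succ_row _ (Fin.last N), Finset.sum_eq_single (Fin.last N)]
    · simp only [Matrix.of_apply, Fin.val_last, hl N hmN]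
      rw [← two_mul, pow_mul]
      have : ((0 : ℕ) : ℤ) + N - N = 0 := by simp
      rw [this, hh_zero]
      simp only [neg_one_sq, one_pow, mul_one, one_mul, Fin.succAbove_last]
      congr 1
    · intro j _ hj
      have hjN : (j : ℕ) < N := by
        have := j.2
        have h2 : (j : ℕ) ≠ N := fun h => hj (Fin.ext h)
        omega
      have : hh (((l N : ℕ) : ℤ) + j - N) = 0 := by
        rw [hl N hmN, hh, if_pos]
        omega
      simp only [Matrix.of_apply, Fin.val_last, this]
      simp
    · simp

theorem schur_eq (m : Multiset ℕ) (L : List ℕ) (hL : sortedParts m = L) :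
    schur m = Matrix.det (Matrix.of fun i j : Fin L.length =>
      hh ((L.getD i 0 : ℤ) + (j : ℤ) - (i : ℤ))) := by
  have hc : Multiset.card m = L.length := by
    rw [← hL, sortedParts]
    simp
  subst hL
  rw [schur]
  generalize sortedParts m = L at *
  generalize Multiset.card m = c at *
  subst hc
  rfl

theorem sortedParts_coe (L : List ℕ) (h : L.Pairwise (· ≥ ·)) : sortedParts (L : Multiset ℕ) = L := by
  rw [sortedParts]
  apply List.Perm.eq_of_pairwise' (r := (· ≥ ·))
  · rw [List.pairwise_reverse]
    exact Multiset.pairwise_sort _ _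
  · exact h
  · refine (List.reverse_perm _).trans ?_
    rw [← Multiset.coe_eq_coe, Multiset.sort_eq]

/-- exponent attached to the row `c` -/
def fsgn {N : ℕ} (S : Finset (Fin N)) (c : Fin N) : ℤ := if c ∈ S then (c : ℤ) else -(c : ℤ)

theorem det_sort {N : ℕ} (S : Finset (Fin N)) (h0 : ∀ c ∈ S, (c : ℕ) ≠ 0) (g : Fin N → ℤ)
    (hg : StrictAnti g) (hfg : ∀ i, ∃ c, fsgn S c = g i) :
    Matrix.det (Matrix.of fun i j : Fin N => hh ((j : ℤ) + g i))
      = (-1) ^ (∑ c ∈ S, (c : ℕ)) *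
        Matrix.det (Matrix.of fun c j : Fin N => hh ((j : ℤ) + fsgn S c)) := by
  choose τ hτ using hfg
  have hinj : Function.Injective τ := by
    intro a b hab
    apply hg.injective
    rw [← hτ, ← hτ, hab]
  let e : Equiv.Perm (Fin N) := Equiv.ofBijective τ (Finite.injective_iff_bijective.1 hinj)
  have he : ∀ i, g i = fsgn S (e i) := fun i => (hτ i).symm
  have h1 : (Matrix.of fun i j : Fin N => hh ((j : ℤ) + g i))
      = (Matrix.of fun c j : Fin N => hh ((j : ℤ) + fsgn S c)).submatrix e id := by
    ext1 i j
    simp [he]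
  rw [h1, Matrix.det_permute]
  congr 1
  have hs : (Equiv.Perm.sign e⁻¹ : ℤ) = (-1) ^ (∑ c ∈ S, (c : ℕ)) := by
    have h2 := Equiv.Perm.prod_Iio_comp_eq_sign_mul_prod (R := ℤ) e⁻¹
      (f := fun i j => Int.sign (g i - g j)) (by
        intro i j
        rw [← Int.sign_neg, neg_sub])
    have h3 : ∏ j : Fin N, ∏ i ∈ Finset.Iio j, Int.sign (g i - g j) = 1 := by
      refine Finset.prod_eq_one fun j _ => Finset.prod_eq_one fun i hi => ?_
      have := hg (Finset.mem_Iio.1 hi)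
      exact Int.sign_eq_one_of_pos (by omega)
    rw [h3, mul_one] at h2
    rw [show ((Equiv.Perm.sign e⁻¹ : ℤˣ) : ℤ) = (((Equiv.Perm.sign e⁻¹ : ℤˣ) : ℤ) : ℤ) from rfl]
    have h4 : ∀ c, g (e⁻¹ c) = fsgn S c := by
      intro c
      rw [he]
      simp
    simp only [h4] at h2
    rw [Int.cast_id] at h2
    rw [← h2]
    have h5 : ∀ j : Fin N, ∏ i ∈ Finset.Iio j, Int.sign (fsgn S i - fsgn S j)
        = if j ∈ S then (-1) ^ (j : ℕ) else 1 := by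
      intro j
      have h6 : ∀ i ∈ Finset.Iio j, Int.sign (fsgn S i - fsgn S j) = if j ∈ S then -1 else 1 := by
        intro i hi
        have hij0 : i < j := Finset.mem_Iio.1 hi
        have hij : (i : ℕ) < j := hij0
        split_ifs with hj
        · apply Int.sign_eq_neg_one_of_neg
          simp only [fsgn, hj, if_true]
          split_ifs <;> omega
        · apply Int.sign_eq_one_of_pos
          simp only [fsgn, hj, if_false]
          split_ifs <;> omega
      rw [Finset.prod_congr rfl h6, Finset.prod_const, Fin.card_Iio]
      split_ifs <;> simp
    rw [Finset.prod_congr rfl fun j _ => h5 j, Finset.prod_ite, Finset.prod_const_one, mul_one,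
      Finset.prod_pow_eq_pow_sum]
    simp
  rw [Equiv.Perm.sign_inv] at hs
  rw [hs]
  simp

theorem schur_gamma (β : Multiset ℕ) (hnd : β.Nodup) (hpos : 0 ∉ β) (N : ℕ) (hN0 : 0 < N)
    (hN : ∀ c ∈ β, c < N) :
    schur (gammaFrob β) =
      (-1) ^ (∑ c ∈ (Finset.univ.filter fun c : Fin N => (c : ℕ) ∈ β), (c : ℕ)) *
        Matrix.det (Matrix.of fun c j : Fin N =>
          hh ((j : ℤ) + fsgn (Finset.univ.filter fun c : Fin N => (c : ℕ) ∈ β) c)) := by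
  set b := sortedParts β with hb
  set r := b.length with hr
  set B : ℕ → ℕ := fun i => b.getD i 0 with hBdef
  have hmem : ∀ c, c ∈ b ↔ c ∈ β := by
    intro c
    rw [hb, sortedParts]
    simp
  have hBget : ∀ i (h : i < r), B i = b[i] := by
    intro i h
    simp only [hBdef]
    exact List.getD_eq_getElem _ _ h
  have hBmem : ∀ i, i < r → B i ∈ β := by
    intro i h
    rw [hBget i h, ← hmem]
    exact List.getElem_mem _
  have hsorted : b.Pairwise (· > ·) := by
    have h1 : b.Pairwise (· ≥ ·) := by
      rw [hb, sortedParts, List.pairwise_reverse]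
      exact Multiset.pairwise_sort _ _
    have h2 : b.Nodup := by
      rw [hb, sortedParts, List.nodup_reverse, ← Multiset.coe_nodup, Multiset.sort_eq]
      exact hnd
    refine (h1.and h2).imp ?_
    rintro x y ⟨hxy, hne⟩
    exact lt_of_le_of_ne hxy (Ne.symm hne)
  have hs : ∀ i j, i < j → j < r → B j < B i := by
    intro i j hij hj
    rw [hBget i (by omega), hBget j hj]
    exact List.pairwise_iff_getElem.1 hsorted i j (by omega) hj hij
  have hp : ∀ i < r, 0 < B i := by
    intro i hi
    rcases Nat.eq_zero_or_pos (B i) with h | h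
    · exact absurd (h ▸ hBmem i hi) hpos
    · exact h
  have hB := B_mono B r hs
  have hanti := lam_anti B r hs hp
  set m := r + (B 0 + 1 - r) with hm
  have hgam : gammaFrob β = (((List.range m).map (lam B r) : List ℕ) : Multiset ℕ) := by
    have h1 : (List.range m).map (lam B r) = ((List.range r).map fun i => b.getD i 0 + i)
        ++ ((List.range (b.getD 0 0 + 1 - r)).map fun t =>
        ((List.range r).filter fun j => r + t ≤ b.getD j 0 + j).length) := by
      rw [hm, List.range_add, List.map_append, List.map_map]
      congr 1
      · apply List.map_congr_left
        intro i hi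
        rw [lam, if_pos (List.mem_range.1 hi)]
      · apply List.map_congr_left
        intro t _
        simp only [Function.comp]
        rw [lam, if_neg (by omega)]
        rfl
    rw [h1]
    rfl
  have hsp : sortedParts (gammaFrob β) = (List.range m).map (lam B r) := by
    rw [hgam]
    apply sortedParts_coe
    rw [List.pairwise_map]
    refine (List.pairwise_lt_range (n := m)).imp ?_
    intro i j hij
    exact hanti i j hij.le
  have hrB : r = 0 ∨ (0 < r ∧ r ≤ B 0) := by
    rcases Nat.eq_zero_or_pos r with h | h
    · exact Or.inl h
    · right
      have h1 := hB 0 (r - 1) (by omega) (by omega)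
      have h2 := hp (r - 1) (by omega)
      omega
  have hB0 : r = 0 → B 0 = 0 := by
    intro h
    simp only [hBdef]
    apply List.getD_eq_default
    omega
  have hmN : m ≤ N := by
    rcases hrB with h | ⟨h, h'⟩
    · have := hB0 h
      omega
    · have := hN _ (hBmem 0 h)
      omega
  have e1 : schur (gammaFrob β) = Matrix.det (Matrix.of fun i j : Fin m =>
      hh ((lam B r i : ℤ) + (j : ℤ) - (i : ℤ))) := by
    rw [schur_eq _ _ hsp]
    have hlen : ((List.range m).map (lam B r)).length = m := by simp
    have hget : ∀ i < m, ((List.range m).map (lam B r)).getD i 0 = lam B r i := by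
      intro i hi
      rw [List.getD_eq_getElem _ _ (by simpa using hi)]
      simp
    generalize (List.range m).map (lam B r) = L at *
    clear_value m
    subst hlen
    congr 1
    ext1 i j
    simp only [Matrix.of_apply]
    rw [hget i i.2]
  rw [e1, ← det_pad (lam B r) m N hmN]
  · have e2 : (Matrix.of fun i j : Fin N => hh ((lam B r i : ℤ) + (j : ℤ) - (i : ℤ)))
        = Matrix.of fun i j : Fin N => hh ((j : ℤ) + ((lam B r i : ℤ) - (i : ℤ))) := by
      ext1 i j
      simp only [Matrix.of_apply]
      congr 1
      ring
    rw [e2]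
    apply det_sort _ _ (fun i : Fin N => (lam B r i : ℤ) - (i : ℤ))
    · intro i j hij
      have h1 := hanti i j (le_of_lt hij)
      have h2 : (i : ℕ) < j := hij
      simp only
      omega
    · intro i
      by_cases hi : (i : ℕ) < r
      · refine ⟨⟨B i, hN _ (hBmem i hi)⟩, ?_⟩
        simp [fsgn, hBmem i hi, lam, hi]
      · obtain ⟨c1, c2⟩ := cnt_spec B r i hB
        refine ⟨⟨i - cnt B r i, lt_of_le_of_lt (Nat.sub_le _ _) i.2⟩, ?_⟩
        have hni : (i : ℕ) - cnt B r i ∉ β := by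
          intro hmemi
          rw [← hmem, List.mem_iff_getElem] at hmemi
          obtain ⟨j, hj, hje⟩ := hmemi
          rw [← hBget j hj] at hje
          have := c2 j hj
          omega
        simp only [fsgn, Finset.mem_filter, Finset.mem_univ, true_and, hni, if_false, lam, hi]
        rw [Nat.cast_sub (by omega)]
        ring
    · intro c hc h
      simp only [Finset.mem_filter, Finset.mem_univ, true_and] at hc
      exact hpos (h ▸ hc)
  · intro i hi
    apply lam_zero B r hs i (by omega)
    omega

end Comb

/-! ### Part 5: assembling -/

section Final

variable {K : Type*} [Field K] [Algebra ℚ K]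

theorem coeff_det_Amat {n : ℕ} (x : Fin (n + 1) → K) (k : ℕ) :
    (Amat x (-Polynomial.X)).det.coeff k =
      ∑ S ∈ (Finset.univ : Finset (Finset (Fin (n + 1)))).filter
          (fun S : Finset (Fin (n + 1)) => (0 : Fin (n + 1)) ∉ S ∧ ∑ c ∈ S, (c : ℕ) = k),
        ev Finset.univ x ((-1) ^ (∑ c ∈ S, (c : ℕ)) *
          Matrix.det (Matrix.of fun c j : Fin (n + 1) => hh ((j : ℤ) + fsgn S c))) := by
  classical
  set U : Fin (n + 1) → Fin (n + 1) → Polynomial K := fun b i =>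
    Polynomial.C (ev Finset.univ x (hh ((i : ℤ) + (-(b : ℤ))))) with hU
  set W : Fin (n + 1) → Fin (n + 1) → Polynomial K := fun b i =>
    if (b : ℕ) = 0 then 0 else
      (-Polynomial.X) ^ (b : ℕ) * Polynomial.C (ev Finset.univ x (hh ((i : ℤ) + b))) with hW
  have hA : (Amat x (-Polynomial.X)).det = ∑ S : Finset (Fin (n + 1)),
      Matrix.det (Matrix.of (S.piecewise W U)) := by
    have h1 : Amat x (-Polynomial.X) = Matrix.of (W + U) := by
      ext1 b i
      simp only [Amat, Matrix.of_apply, Pi.add_apply, hW, hU]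
      rw [add_comm]
    rw [h1]
    exact (Matrix.detRowAlternating (R := Polynomial K) (n := Fin (n + 1))).map_add_univ W U
  have hS : ∀ S : Finset (Fin (n + 1)), (Matrix.det (Matrix.of (S.piecewise W U))).coeff k
      = if (0 : Fin (n + 1)) ∉ S ∧ ∑ c ∈ S, (c : ℕ) = k then
        ev Finset.univ x ((-1) ^ (∑ c ∈ S, (c : ℕ)) *
          Matrix.det (Matrix.of fun c j : Fin (n + 1) => hh ((j : ℤ) + fsgn S c))) else 0 := by
    intro S
    by_cases h0 : (0 : Fin (n + 1)) ∈ S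
    · rw [if_neg (by simp [h0]), Matrix.det_eq_zero_of_row_eq_zero (0 : Fin (n + 1)),
        Polynomial.coeff_zero]
      intro j
      simp [Finset.piecewise, h0, hW]
    · have e1 : Matrix.of (S.piecewise W U) = Matrix.of fun c j : Fin (n + 1) =>
          (if c ∈ S then (-Polynomial.X : Polynomial K) ^ (c : ℕ) else 1) *
          ((Matrix.of fun c j : Fin (n + 1) => hh ((j : ℤ) + fsgn S c)).map
            (Polynomial.C.comp (ev Finset.univ x).toRingHom)) c j := by
        ext1 c j
        by_cases hc : c ∈ S
        · have hc0 : (c : ℕ) ≠ 0 := by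
            intro h
            apply h0
            have : c = 0 := Fin.ext h
            rwa [this] at hc
          simp only [Matrix.of_apply, Finset.piecewise, hc, if_true, hW, hc0, if_false, fsgn,
            Matrix.map_apply]
          rfl
        · simp only [Matrix.of_apply, Finset.piecewise, hc, hU, if_false, fsgn,
            Matrix.map_apply, one_mul]
          rfl
      have e2 : ((Matrix.of fun c j : Fin (n + 1) => hh ((j : ℤ) + fsgn S c)).map
            (Polynomial.C.comp (ev Finset.univ x).toRingHom)).det
          = Polynomial.C (ev Finset.univ x
            (Matrix.det (Matrix.of fun c j : Fin (n + 1) => hh ((j : ℤ) + fsgn S c)))) :=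
        (RingHom.map_det (Polynomial.C.comp (ev Finset.univ x).toRingHom) _).symm
      rw [e1, Matrix.det_mul_column, e2, Finset.prod_ite_mem, Finset.univ_inter,
        Finset.prod_pow_eq_pow_sum, neg_pow, map_mul, map_pow, map_neg, map_one,
        Polynomial.coeff_mul_C]
      have e3 : ((-1 : Polynomial K) ^ (∑ c ∈ S, (c : ℕ)) * Polynomial.X ^ (∑ c ∈ S, (c : ℕ)))
          = Polynomial.C ((-1 : K) ^ (∑ c ∈ S, (c : ℕ))) * Polynomial.X ^ (∑ c ∈ S, (c : ℕ)) := by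
        simp
      rw [e3, Polynomial.coeff_C_mul_X_pow]
      by_cases hk : ∑ c ∈ S, (c : ℕ) = k
      · simp [h0, hk]
      · rw [if_neg (fun h => hk h.symm), if_neg (fun h => hk h.2), zero_mul]
  rw [hA, Polynomial.finsetSum_coeff, Finset.sum_congr rfl fun S _ => hS S, Finset.sum_filter]

theorem prod_pairs {n : ℕ} {R : Type*} [CommRing R] (x : Fin n → R) :
    Eser ((Finset.univ : Finset (Fin n)).powersetCard 2) (fun t => ∏ i ∈ t, x i)
      = ∏ i, ∏ j ∈ Finset.Ioi i, (1 + PowerSeries.C (x i * x j) * PowerSeries.X) := by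
  rw [Eser, Finset.prod_sigma']
  symm
  refine Finset.prod_bij (fun p _ => {p.1, p.2}) ?_ ?_ ?_ ?_
  · rintro ⟨i, j⟩ h
    have hij : i < j := by simpa using h
    rw [Finset.mem_powersetCard]
    exact ⟨Finset.subset_univ _, Finset.card_pair hij.ne⟩
  · rintro ⟨i, j⟩ h ⟨i', j'⟩ h' heq
    have hij : i < j := by simpa using h
    have hij' : i' < j' := by simpa using h'
    have heq' : ({i, j} : Finset (Fin n)) = {i', j'} := heq
    have a1 : i ∈ ({i', j'} : Finset (Fin n)) := by rw [← heq']; simp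
    have a2 : j ∈ ({i', j'} : Finset (Fin n)) := by rw [← heq']; simp
    simp only [Finset.mem_insert, Finset.mem_singleton] at a1 a2
    have hi : i = i' := by
      rcases a1 with a1 | a1
      · exact a1
      · rcases a2 with a2 | a2
        · subst a1 a2
          exact absurd hij (not_lt.2 hij'.le)
        · subst a1 a2
          exact absurd hij (lt_irrefl _)
    have hj : j = j' := by
      rcases a2 with a2 | a2
      · subst hi a2
        exact absurd hij (lt_irrefl _)
      · exact a2
    subst hi hj
    rfl
  · intro t ht
    obtain ⟨a, b, hab, rfl⟩ := Finset.card_eq_two.1 (Finset.mem_powersetCard.1 ht).2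
    rcases lt_or_gt_of_ne hab with h | h
    · exact ⟨⟨a, b⟩, by simpa using h, rfl⟩
    · exact ⟨⟨b, a⟩, by simpa using h, Finset.pair_comm _ _⟩
  · rintro ⟨i, j⟩ h
    have hij : i < j := by simpa using h
    rw [Finset.prod_pair hij.ne]

theorem sum_strict {M : Type*} [AddCommMonoid M] (k n : ℕ) (hkn : k ≤ n)
    (F : Finset (Fin (n + 1)) → M) :
    ∑ β : {β : Nat.Partition k // β.parts.Nodup},
        F (Finset.univ.filter fun c : Fin (n + 1) => (c : ℕ) ∈ β.1.parts)
      = ∑ S ∈ (Finset.univ : Finset (Finset (Fin (n + 1)))).filter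
          (fun S : Finset (Fin (n + 1)) => (0 : Fin (n + 1)) ∉ S ∧ ∑ c ∈ S, (c : ℕ) = k), F S := by
  classical
  have hle : ∀ β : Nat.Partition k, ∀ c ∈ β.parts, c < n + 1 := by
    intro β c hc
    have := Multiset.le_sum_of_mem hc
    rw [β.parts_sum] at this
    omega
  have hmap : ∀ β : {β : Nat.Partition k // β.parts.Nodup},
      (Finset.univ.filter fun c : Fin (n + 1) => (c : ℕ) ∈ β.1.parts).val.map Fin.val
        = β.1.parts := by
    intro β
    refine (Multiset.Nodup.ext (Multiset.Nodup.map Fin.val_injective (Finset.nodup _)) β.2).2 ?_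
    intro a
    simp only [Multiset.mem_map, Finset.mem_val, Finset.mem_filter, Finset.mem_univ, true_and]
    constructor
    · rintro ⟨c, hc, rfl⟩
      exact hc
    · intro ha
      exact ⟨⟨a, hle _ a ha⟩, ha, rfl⟩
  refine Finset.sum_bij
    (fun (β : {β : Nat.Partition k // β.parts.Nodup}) _ => Finset.univ.filter fun c : Fin (n + 1) => (c : ℕ) ∈ β.1.parts) ?_ ?_ ?_ ?_
  · intro β _
    simp only [Finset.mem_filter, Finset.mem_univ, true_and]
    refine ⟨fun h => ?_, ?_⟩
    · exact absurd (β.1.parts_pos h) (by simp)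
    · have h := congrArg Multiset.sum (hmap β)
      rw [β.1.parts_sum] at h
      exact h
  · intro β _ γ _ h
    apply Subtype.ext
    apply Nat.Partition.ext
    rw [← hmap β, ← hmap γ]
    beta_reduce at h
    rw [h]
  · intro S hS
    simp only [Finset.mem_filter, Finset.mem_univ, true_and] at hS
    refine ⟨⟨⟨S.val.map Fin.val, ?_, hS.2⟩, ?_⟩, Finset.mem_univ _, ?_⟩
    · intro i hi
      obtain ⟨c, hc, rfl⟩ := Multiset.mem_map.1 hi
      rcases Nat.eq_zero_or_pos (c : ℕ) with h | h
      · have : c = 0 := Fin.ext h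
        rw [this] at hc
        exact absurd hc hS.1
      · exact h
    · exact Multiset.Nodup.map Fin.val_injective S.nodup
    · ext c
      simp only [Finset.mem_filter, Finset.mem_univ, true_and, Multiset.mem_map, Finset.mem_val]
      constructor
      · rintro ⟨d, hd, hdc⟩
        rwa [← Fin.ext hdc]
      · intro h
        exact ⟨c, h, rfl⟩
  · intro β _
    rfl

theorem ev_main {n : ℕ} (x : Fin (n + 1) → K) (hx : Function.Injective x) (h0 : ∀ i, x i ≠ 0)
    (k : ℕ) (hkn : k ≤ n) :
    ev Finset.univ x (pleth (ee k) (ee 2)) = ev Finset.univ x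
      (∑ β : {β : Nat.Partition k // β.parts.Nodup}, schur (gammaFrob β.1.parts)) := by
  have h1 := congrArg (fun p => Polynomial.coeff p k) (det_Amat x hx h0 (-Polynomial.X))
  beta_reduce at h1
  rw [coeff_det_Amat, ← sum_strict k n hkn (fun S => ev Finset.univ x
    ((-1) ^ (∑ c ∈ S, (c : ℕ)) *
          Matrix.det (Matrix.of fun c j : Fin (n + 1) => hh ((j : ℤ) + fsgn S c))))] at h1
  rw [ev_pleth_ee, prod_pairs, map_sum]
  have h2 : ∀ β : {β : Nat.Partition k // β.parts.Nodup}, schur (gammaFrob β.1.parts) = _ :=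
    fun β => schur_gamma β.1.parts β.2 (fun h => absurd (β.1.parts_pos h) (by simp)) (n + 1)
      (by omega) (by
        intro c hc
        have := Multiset.le_sum_of_mem hc
        rw [β.1.parts_sum] at this
        omega)
  simp_rw [h2]
  rw [h1, ← Polynomial.coeff_coe]
  congr 1
  rw [← Polynomial.coeToPowerSeries.ringHom_apply, map_prod]
  refine Finset.prod_congr rfl fun i _ => ?_
  rw [map_prod]
  refine Finset.prod_congr rfl fun j _ => ?_
  rw [Polynomial.coeToPowerSeries.ringHom_apply]
  simp only [neg_mul, sub_neg_eq_add, Polynomial.coe_add, Polynomial.coe_one, Polynomial.coe_mul,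
    Polynomial.coe_X, Polynomial.coe_C]
  rw [mul_comm]

end Final

/-- `e_k ∘ e₂ = ∑_{β ⊢ k strict} s_{Γ(β)}` where
`Γ(β) = (β₁-1, β₂-1, … | β₁, β₂, …)` in Frobenius notation. -/
theorem ek_pleth_e2 (k : ℕ) :
    pleth (ee k) (ee 2) =
      ∑ β : {β : Nat.Partition k // β.parts.Nodup}, schur (gammaFrob β.1.parts) := by
  rw [← sub_eq_zero]
  apply symfn_inj _ k
  intro N hN
  obtain ⟨n, rfl⟩ : ∃ n, N = n + 1 := ⟨N - 1, by omega⟩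
  rw [map_sub, sub_eq_zero]
  apply ev_main _ _ _ k (by omega)
  · intro i j hij
    exact MvPolynomial.X_injective (IsFractionRing.injective (MvPolynomial (Fin (n + 1)) ℚ) _ hij)
  · intro i h
    rw [IsFractionRing.to_map_eq_zero_iff] at h
    exact MvPolynomial.X_ne_zero i h
end

section
/- Let λ be a partition and suppose the symmetric function s_λ ∘ h₂ is expanded in the Schur basis. Then every partition κ appearing with nonzero coefficient satisfies κ₁ ≤ |λ| + λ₁; equivalently, Φ(s_λ ∘ h₂) ≤ |λ| + λ₁. -/
open MvPolynomial Finset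

/-! Helper material: the algebra map `f ↦ f[X + t]` and its degree in `t`. -/

namespace PhiProof

/-- `h_n[X+t]` for natural `n`. -/
noncomputable def HN : ℕ → Polynomial SymFn
  | 0 => 1
  | (n+1) => Polynomial.C (hh ((n : ℤ) + 1)) + Polynomial.X * HN n

/-- Extension of a sequence by zero to the integers. -/
noncomputable def ext0 (f : ℕ → Polynomial SymFn) (n : ℤ) : Polynomial SymFn :=
  if n < 0 then 0 else f n.toNat

/-- The map `f ↦ f[X+t]`. -/
noncomputable def DD : SymFn →ₐ[ℚ] Polynomial SymFn := aeval fun m => HN (m+1)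

lemma hh_zero : hh 0 = 1 := by simp [hh]

lemma hh_neg {n : ℤ} (h : n < 0) : hh n = 0 := by simp [hh, h]

lemma hh_succ (n : ℕ) : hh ((n : ℤ) + 1) = MvPolynomial.X n := by
  unfold hh
  rw [if_neg (by omega), if_neg (by omega)]
  congr 1

lemma int_cases (n : ℤ) : n < 0 ∨ n = 0 ∨ ∃ k : ℕ, n = (k : ℤ) + 1 := by
  rcases lt_trichotomy n 0 with h | h | h
  · exact Or.inl h
  · exact Or.inr (Or.inl h)
  · exact Or.inr (Or.inr ⟨(n - 1).toNat, by omega⟩)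

lemma ext0_neg (f) {n : ℤ} (h : n < 0) : ext0 f n = 0 := by simp [ext0, h]

lemma ext0_nat (f) (n : ℕ) : ext0 f n = f n := by simp [ext0]

lemma ext0_succ (f) (n : ℕ) : ext0 f ((n : ℤ) + 1) = f (n + 1) := by
  exact_mod_cast ext0_nat f (n + 1)

lemma ext0_zero (f) : ext0 f 0 = f 0 := by simp [ext0]

lemma algHom_hh (F : SymFn →ₐ[ℚ] Polynomial SymFn) (f : ℕ → Polynomial SymFn) (h0 : f 0 = 1)
    (hf : ∀ m, F (MvPolynomial.X m) = f (m+1)) (n : ℤ) : F (hh n) = ext0 f n := by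
  rcases int_cases n with h | rfl | ⟨k, rfl⟩
  · rw [hh_neg h, ext0_neg _ h, map_zero]
  · rw [hh_zero, ext0_zero, map_one, h0]
  · rw [hh_succ, hf, ext0_succ]

lemma DD_hh (n : ℤ) : DD (hh n) = ext0 HN n :=
  algHom_hh _ _ rfl (fun m => by simp [DD]) n

lemma DD_hh_nat (n : ℕ) : DD (hh n) = HN n := by rw [DD_hh, ext0_nat]

lemma HZ_rec (n : ℤ) : ext0 HN n = Polynomial.C (hh n) + Polynomial.X * ext0 HN (n - 1) := by
  rcases int_cases n with h | rfl | ⟨k, rfl⟩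
  · rw [hh_neg h, ext0_neg _ h, ext0_neg _ (by omega)]; simp
  · rw [hh_zero, ext0_zero, ext0_neg _ (by omega)]; simp [HN]
  · rw [ext0_succ, add_sub_cancel_right, ext0_nat, HN]

lemma HN_coeff (n m : ℕ) : (HN n).coeff m = hh ((n : ℤ) - m) := by
  induction n generalizing m with
  | zero =>
    rcases Nat.eq_zero_or_pos m with rfl | h
    · simp [HN, hh_zero]
    · rw [hh_neg (by omega), HN, Polynomial.coeff_one, if_neg (by omega)]
  | succ n ih =>
    rcases m with _ | m
    · simp [HN]
    · rw [HN, Polynomial.coeff_add, Polynomial.coeff_X_mul, ih, Polynomial.coeff_C,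
        if_neg (by omega), zero_add]
      congr 1; push_cast; ring

lemma HZ_coeff (n : ℤ) (m : ℕ) : (ext0 HN n).coeff m = hh (n - m) := by
  by_cases h : n < 0
  · rw [ext0_neg _ h, hh_neg (by omega)]; simp
  · obtain ⟨k, rfl⟩ := Int.eq_ofNat_of_zero_le (not_lt.mp h)
    rw [ext0_nat, HN_coeff]

lemma det_col {R : Type*} [CommRing R] (a b : ℤ → R) (x : R) (h : ∀ n, b n = a n + x * b (n-1))
    (n : ℕ) (v : ℕ → ℕ) :
    Matrix.det (Matrix.of fun i j : Fin (n+1) => b ((v i : ℤ) + (j:ℤ) - (i:ℤ))) =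
    Matrix.det (Matrix.of fun i j : Fin (n+1) =>
      if j = 0 then b ((v i : ℤ) - (i:ℤ)) else a ((v i : ℤ) + (j:ℤ) - (i:ℤ))) := by
  apply Matrix.det_eq_of_forall_col_eq_smul_add_pred (fun _ => x)
  · intro i; simp
  · intro i j
    simp only [Matrix.of_apply, Fin.succ_ne_zero, if_false]
    rw [h]
    congr 3
    simp only [Fin.val_succ, Fin.val_castSucc]; push_cast; ring

/-- Jacobi–Trudi determinant. -/
noncomputable def jt (n : ℕ) (v : ℕ → ℕ) : SymFn :=
  Matrix.det (Matrix.of fun i j : Fin n => hh ((v i : ℤ) + (j : ℤ) - (i : ℤ)))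

lemma map_jt (F : SymFn →ₐ[ℚ] Polynomial SymFn) (n : ℕ) (v : ℕ → ℕ) : F (jt n v) =
    Matrix.det (Matrix.of fun i j : Fin n => F (hh ((v i : ℤ) + (j:ℤ) - (i:ℤ)))) := by
  unfold jt
  rw [AlgHom.map_det]; rfl

lemma DD_jt_coeff (n : ℕ) (v : ℕ → ℕ) (m : ℕ) (hm : ∀ i, i ≤ n → v i ≤ m) :
    (DD (jt (n+1) v)).coeff m = if v 0 = m then jt n (fun i => v (i+1)) else 0 := by
  rw [map_jt]
  simp only [DD_hh]
  rw [det_col (fun n => Polynomial.C (hh n)) (ext0 HN) Polynomial.X HZ_rec]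
  rw [Matrix.det_succ_column_zero, Polynomial.finsetSum_coeff]
  have key : ∀ i : Fin (n+1), ((-1) ^ (i:ℕ) * (Matrix.of fun i j : Fin (n+1) =>
      if j = 0 then ext0 HN ((v i : ℤ) - (i:ℤ)) else
        Polynomial.C (hh ((v i : ℤ) + (j:ℤ) - (i:ℤ)))) i 0 *
      Matrix.det ((Matrix.of fun i j : Fin (n+1) =>
      if j = 0 then ext0 HN ((v i : ℤ) - (i:ℤ)) else
        Polynomial.C (hh ((v i : ℤ) + (j:ℤ) - (i:ℤ)))).submatrix i.succAbove Fin.succ)).coeff m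
      = (-1) ^ (i:ℕ) * hh ((v i : ℤ) - i - m) * Matrix.det (Matrix.of fun k j : Fin n =>
        hh ((v (i.succAbove k) : ℤ) + (j:ℤ) + 1 - (i.succAbove k : ℕ))) := by
    intro i
    have h1 : ((Matrix.of fun i j : Fin (n+1) =>
      if j = 0 then ext0 HN ((v i : ℤ) - (i:ℤ)) else
        Polynomial.C (hh ((v i : ℤ) + (j:ℤ) - (i:ℤ)))).submatrix i.succAbove Fin.succ) =
        (Polynomial.C : SymFn →+* _).mapMatrix (Matrix.of fun k j : Fin n =>
        hh ((v (i.succAbove k) : ℤ) + (j:ℤ) + 1 - (i.succAbove k : ℕ))) := by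
      ext1 k j
      simp [Fin.succ_ne_zero, add_assoc]
    rw [h1, ← RingHom.map_det, Polynomial.coeff_mul_C]
    congr 1
    have h2 : ((-1 : Polynomial SymFn)) ^ (i:ℕ) = Polynomial.C ((-1) ^ (i:ℕ)) := by simp
    rw [h2, Polynomial.coeff_C_mul]
    congr 1
    simp [HZ_coeff]
  rw [Finset.sum_congr rfl (fun i _ => key i), Finset.sum_eq_single 0]
  · split_ifs with h
    · simp [h, hh_zero, jt]
    · have := hm 0 (Nat.zero_le _)
      rw [hh_neg]
      · simp
      · simp; omega
  · intro i _ hi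
    have := hm i (by omega)
    have : (i : ℕ) ≠ 0 := fun h => hi (Fin.ext h)
    rw [hh_neg (by omega)]; simp
  · simp

/-! Sorted parts. -/

lemma sortedParts_cons (M : ℕ) (μ : Multiset ℕ) (h : ∀ x ∈ μ, x ≤ M) :
    sortedParts (M ::ₘ μ) = M :: sortedParts μ := by
  unfold sortedParts
  rw [← List.reverse_concat, ← List.concat_eq_append]
  congr 1
  apply List.Perm.eq_of_pairwise (le := (· ≤ ·))
  · intro a b _ _ h1 h2; exact le_antisymm h1 h2
  · exact Multiset.pairwise_sort _ _
  · rw [List.concat_eq_append, List.pairwise_append]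
    refine ⟨Multiset.pairwise_sort _ _, by simp, ?_⟩
    intro a ha b hb
    simp at ha hb
    subst hb
    exact h a ha
  · rw [← Multiset.coe_eq_coe]
    rw [List.concat_eq_append, ← Multiset.coe_add, Multiset.sort_eq, Multiset.sort_eq]
    rw [add_comm]; rfl

/-- parts as a function -/
def vv (m : Multiset ℕ) (i : ℕ) : ℕ := (sortedParts m).getD i 0

lemma schur_eq (m : Multiset ℕ) : schur m = jt (Multiset.card m) (vv m) := rfl

lemma length_sortedParts (m : Multiset ℕ) : (sortedParts m).length = Multiset.card m := by
  simp [sortedParts]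

lemma mem_sortedParts (m : Multiset ℕ) (x : ℕ) : x ∈ sortedParts m ↔ x ∈ m := by
  simp [sortedParts]

lemma vv_le (m : Multiset ℕ) (i : ℕ) : vv m i ≤ m.sup := by
  unfold vv
  by_cases h : i < (sortedParts m).length
  · rw [List.getD_eq_getElem _ _ h]
    exact Multiset.le_sup ((mem_sortedParts m _).1 (List.getElem_mem h))
  · rw [List.getD_eq_default _ _ (not_lt.mp h)]; exact Nat.zero_le _

lemma sum_vv (m : Multiset ℕ) : ∑ i : Fin (Multiset.card m), vv m i = m.sum := by
  have h1 : (sortedParts m).sum = m.sum := by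
    rw [← Multiset.sum_coe]
    congr 1
    unfold sortedParts
    rw [Multiset.coe_reverse, Multiset.sort_eq]
  rw [← h1, ← length_sortedParts, ← Fin.sum_univ_getElem]
  apply Finset.sum_congr rfl
  intro i _
  simp [vv]

lemma sup_mem (m : Multiset ℕ) (h : 0 < m.sup) : m.sup ∈ m := by
  induction m using Multiset.induction_on with
  | empty => simp at h
  | cons a s ih =>
    rw [Multiset.sup_cons] at h ⊢
    rcases le_total a s.sup with h' | h'
    · rw [sup_eq_right.2 h'] at h ⊢
      exact Multiset.mem_cons_of_mem (ih h)
    · rw [sup_eq_left.2 h']; exact Multiset.mem_cons_self _ _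

lemma DD_schur_coeff (κ : Multiset ℕ) (m : ℕ) (hm : 0 < m) (hκ : κ.sup ≤ m) :
    (DD (schur κ)).coeff m = if κ.sup = m then schur (κ.erase m) else 0 := by
  by_cases h0 : 0 < κ.sup
  · obtain ⟨μ, hμ⟩ := Multiset.exists_cons_of_mem (sup_mem κ h0)
    have hle : ∀ x ∈ μ, x ≤ κ.sup := fun x hx =>
      Multiset.le_sup (by rw [hμ]; exact Multiset.mem_cons_of_mem hx)
    have hs := sortedParts_cons _ _ hle
    rw [← hμ] at hs
    have hc : Multiset.card κ = Multiset.card μ + 1 := by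
      conv_lhs => rw [hμ]
      simp
    have hv0 : vv κ 0 = κ.sup := by simp [vv, hs]
    have hv1 : (fun i => vv κ (i+1)) = vv μ := by funext i; simp [vv, hs]
    rw [schur_eq, hc, DD_jt_coeff _ _ _ (fun i _ => (vv_le κ i).trans hκ), hv0, hv1]
    split_ifs with h
    · rw [schur_eq]
      have : κ.erase m = μ := by
        rw [← h]
        generalize κ.sup = a at hμ
        rw [hμ, Multiset.erase_cons_head]
      rw [this]
    · rfl
  · have hs0 : κ.sup = 0 := by omega
    rw [if_neg (by omega)]
    rw [schur_eq]
    rcases hc : Multiset.card κ with _ | n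
    · simp only [jt, Matrix.det_fin_zero, map_one]
      rw [Polynomial.coeff_one, if_neg (by omega)]
    · rw [DD_jt_coeff _ _ _ (fun i _ => (vv_le κ i).trans hκ), if_neg]
      have := vv_le κ 0
      omega

lemma eq_zero_of_sup {κ : Multiset ℕ} (hp : IsPartition κ) (h : κ.sup = 0) : κ = 0 := by
  apply Multiset.eq_zero_of_forall_notMem
  intro x hx
  have := Multiset.le_sup hx
  have h0 : x = 0 := by omega
  exact hp (h0 ▸ hx)

/-- Extraction of leading coefficients. -/
lemma lead (s : Finset (Multiset ℕ)) (c : Multiset ℕ → ℚ) (M : ℕ) (hM : 0 < M)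
    (hs : ∀ κ ∈ s, κ.sup ≤ M) :
    (DD (∑ κ ∈ s, c κ • schur κ)).coeff M =
      ∑ μ ∈ (s.filter (fun κ => κ.sup = M)).image (fun κ => κ.erase M),
        c (M ::ₘ μ) • schur μ := by
  have hcons : ∀ κ ∈ s.filter (fun κ => κ.sup = M), M ::ₘ κ.erase M = κ := by
    intro κ hκ
    have h := (Finset.mem_filter.1 hκ).2
    apply Multiset.cons_erase
    rw [← h]; exact sup_mem κ (by omega)
  rw [Finset.sum_image]
  · rw [map_sum, Polynomial.finsetSum_coeff, Finset.sum_filter]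
    apply Finset.sum_congr rfl
    intro κ hκ
    rw [map_smul, Polynomial.coeff_smul, DD_schur_coeff κ M hM (hs κ hκ)]
    split_ifs with h
    · rw [hcons κ (Finset.mem_filter.2 ⟨hκ, h⟩)]
    · simp
  · intro a ha b hb hab
    rw [← hcons a ha, ← hcons b hb]
    exact congrArg _ hab

lemma indep (L : ℕ) : ∀ (s : Finset (Multiset ℕ)) (c : Multiset ℕ → ℚ),
    (∀ κ ∈ s, IsPartition κ ∧ Multiset.card κ ≤ L) → ∑ κ ∈ s, c κ • schur κ = 0 →
    ∀ κ ∈ s, c κ = 0 := by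
  induction L with
  | zero =>
    intro s c hs h κ hκ
    have hz : ∀ κ ∈ s, κ = 0 := fun κ hκ => Multiset.card_eq_zero.1 (by have := (hs κ hκ).2; omega)
    have : s = {0} := by
      ext x
      constructor
      · intro hx; simp [hz x hx]
      · intro hx
        rw [Finset.mem_singleton] at hx
        rw [hx, ← hz κ hκ]; exact hκ
    subst this
    rw [hz κ hκ]
    have h1 : schur 0 = 1 := Matrix.det_fin_zero
    rw [Finset.sum_singleton, h1] at h
    simpa using h
  | succ L ih =>
    intro s
    induction s using Finset.strongInduction with
    | H s ihs =>
    intro c hs h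
    by_cases hne : s.Nonempty
    swap
    · intro κ hκ; exact absurd ⟨κ, hκ⟩ hne
    obtain ⟨κ₀, hκ₀, hmax⟩ := Finset.exists_max_image s (fun κ => κ.sup) hne
    by_cases hM : 0 < κ₀.sup
    · have hl := lead s c κ₀.sup hM hmax
      rw [h] at hl
      simp only [map_zero, Polynomial.coeff_zero] at hl
      have hcons : ∀ κ ∈ s, κ.sup = κ₀.sup → κ₀.sup ::ₘ κ.erase κ₀.sup = κ := by
        intro κ hκ h
        apply Multiset.cons_erase
        rw [← h]; exact sup_mem κ (by omega)
      have h1 := ih _ _ ?_ hl.symm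
      · have h2 : ∀ κ ∈ s, κ.sup = κ₀.sup → c κ = 0 := by
          intro κ hκ hk
          rw [← hcons κ hκ hk]
          exact h1 _ (Finset.mem_image.2 ⟨κ, Finset.mem_filter.2 ⟨hκ, hk⟩, rfl⟩)
        have h3 := ihs (s.filter (fun κ => κ.sup ≠ κ₀.sup))
          ((Finset.filter_ssubset).2 ⟨κ₀, hκ₀, by simp⟩) c
          (fun κ hκ => hs κ (Finset.mem_of_mem_filter κ hκ)) (by
            rw [← h, Finset.sum_filter]
            apply Finset.sum_congr rfl
            intro κ hκ
            split_ifs with hh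
            · rfl
            · rw [h2 κ hκ (not_not.1 hh), zero_smul])
        intro κ hκ
        by_cases hk : κ.sup = κ₀.sup
        · exact h2 κ hκ hk
        · exact h3 κ (Finset.mem_filter.2 ⟨hκ, hk⟩)
      · intro μ hμ
        obtain ⟨κ, hκ, rfl⟩ := Finset.mem_image.1 hμ
        obtain ⟨hκs, hk⟩ := Finset.mem_filter.1 hκ
        obtain ⟨hp, hc⟩ := hs κ hκs
        refine ⟨fun h0 => hp (Multiset.mem_of_mem_erase h0), ?_⟩
        have := congrArg Multiset.card (hcons κ hκs hk)
        rw [Multiset.card_cons] at this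
        omega
    · have hz : ∀ κ ∈ s, IsPartition κ ∧ Multiset.card κ ≤ L := by
        intro κ hκ
        have h1 := hmax κ hκ
        have h2 := eq_zero_of_sup (hs κ hκ).1 (by omega)
        exact ⟨(hs κ hκ).1, by simp [h2]⟩
      exact ih s c hz h

/-! Degrees. -/

/-- degree bound with integers -/
def degLE (p : Polynomial SymFn) (d : ℤ) : Prop := ∀ n : ℕ, d < n → p.coeff n = 0

lemma degLE.add {p q d} (hp : degLE p d) (hq : degLE q d) : degLE (p + q) d := by
  intro n hn; rw [Polynomial.coeff_add, hp n hn, hq n hn, add_zero]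

lemma degLE.mono {p d e} (hp : degLE p d) (h : d ≤ e) : degLE p e :=
  fun n hn => hp n (by omega)

lemma degLE.mul {p q d e} (hp : degLE p d) (hq : degLE q e) : degLE (p * q) (d + e) := by
  intro n hn
  rw [Polynomial.coeff_mul]
  apply Finset.sum_eq_zero
  intro x hx
  have := Finset.HasAntidiagonal.mem_antidiagonal.1 hx
  by_cases h : d < x.1
  · rw [hp _ h, zero_mul]
  · rw [hq _ (by omega), mul_zero]

lemma degLE_zero (d) : degLE 0 d := fun n _ => by simp

lemma degLE_C (a : SymFn) : degLE (Polynomial.C a) 0 := fun n hn => by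
  rw [Polynomial.coeff_C, if_neg (by omega)]

lemma degLE_one : degLE 1 0 := by simpa using degLE_C 1

lemma degLE_X_pow (k : ℕ) : degLE (Polynomial.X ^ k) k := fun n hn => by
  rw [Polynomial.coeff_X_pow, if_neg (by omega)]

lemma degLE.smul {p d} (a : ℚ) (hp : degLE p d) : degLE (a • p) d := fun n hn => by
  rw [Polynomial.coeff_smul, hp n hn, smul_zero]

lemma degLE_sum {ι : Type*} (s : Finset ι) (f : ι → Polynomial SymFn) (d : ℤ)
    (h : ∀ i ∈ s, degLE (f i) d) : degLE (∑ i ∈ s, f i) d := fun n hn => by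
  rw [Polynomial.finsetSum_coeff]
  exact Finset.sum_eq_zero fun i hi => h i hi n hn

lemma degLE_prod {ι : Type*} (s : Finset ι) (f : ι → Polynomial SymFn) (d : ι → ℤ)
    (h : ∀ i ∈ s, degLE (f i) (d i)) : degLE (∏ i ∈ s, f i) (∑ i ∈ s, d i) := by
  classical
  induction s using Finset.induction_on with
  | empty => simpa using degLE_one
  | insert a s ha ih =>
    rw [Finset.prod_insert ha, Finset.sum_insert ha]
    exact (h a (by simp)).mul (ih fun i hi => h i (by simp [hi]))

/-! Power sums. -/

lemma HN_sum (n : ℕ) : HN n =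
    ∑ i ∈ Finset.range (n+1), Polynomial.C (hh (i:ℤ)) * Polynomial.X ^ (n - i) := by
  induction n with
  | zero => simp [HN, hh_zero]
  | succ n ih =>
    rw [Finset.sum_range_succ, HN, ih, Finset.mul_sum, add_comm]
    refine congrArg₂ (· + ·) ?_ ?_
    · apply Finset.sum_congr rfl
      intro i hi
      have : n + 1 - i = (n - i) + 1 := by have := Finset.mem_range.1 hi; omega
      rw [this]; ring
    · simp

lemma newton (n : ℕ) : ∑ i ∈ Finset.range (n+1), hh (i:ℤ) * pp (n + 1 - i) =
    ((n : SymFn) + 1) * hh ((n:ℤ)+1) := by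
  rw [Finset.sum_range_succ']
  simp only [Nat.cast_zero, hh_zero, one_mul, Nat.sub_zero]
  conv_lhs => rw [pp]
  have : ∀ i, n + 1 - (i + 1) = n - i := fun i => by omega
  simp only [this]
  push_cast
  rw [add_sub_cancel, Algebra.smul_def]
  simp

lemma newton_H (n : ℕ) : ∑ i ∈ Finset.range n, HN i *
    (Polynomial.C (pp (n - i)) + Polynomial.X ^ (n - i)) = (n : Polynomial SymFn) * HN n := by
  induction n with
  | zero => simp
  | succ n ih =>
    have e1 : ∑ i ∈ Finset.range (n+1), HN i *
        (Polynomial.C (pp (n + 1 - i)) + Polynomial.X ^ (n + 1 - i)) =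
        ∑ i ∈ Finset.range (n+1), Polynomial.C (hh (i:ℤ)) *
          (Polynomial.C (pp (n + 1 - i)) + Polynomial.X ^ (n + 1 - i)) +
        Polynomial.X * ∑ i ∈ Finset.range n, HN i *
        (Polynomial.C (pp (n - i)) + Polynomial.X ^ (n - i)) := by
      rw [Finset.sum_range_succ', Finset.sum_range_succ' _ n, Finset.mul_sum]
      have : ∀ i, n + 1 - (i + 1) = n - i := fun i => by omega
      simp only [this, HN, Nat.cast_zero, hh_zero, map_one]
      rw [add_right_comm, ← Finset.sum_add_distrib]
      congr 1
      apply Finset.sum_congr rfl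
      intro i _
      push_cast
      ring
    rw [e1, ih]
    simp only [mul_add, Finset.sum_add_distrib, ← map_mul, ← map_sum]
    rw [newton]
    have e2 : ∑ i ∈ Finset.range (n+1), Polynomial.C (hh (i:ℤ)) * Polynomial.X ^ (n + 1 - i) =
        Polynomial.X * HN n := by
      rw [HN_sum, Finset.mul_sum]
      apply Finset.sum_congr rfl
      intro i hi
      have : n + 1 - i = (n - i) + 1 := by have := Finset.mem_range.1 hi; omega
      rw [this]; ring
    rw [e2, HN]
    simp only [map_mul, map_add, map_one, map_natCast]
    push_cast
    ring

lemma DD_pp (n : ℕ) : DD (pp (n+1)) = Polynomial.C (pp (n+1)) + Polynomial.X ^ (n+1) := by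
  induction n using Nat.strong_induction_on with
  | _ n ih =>
    have h1 := newton_H (n+1)
    have h2 := congrArg DD (newton n)
    rw [Finset.sum_range_succ'] at h1 h2
    rw [map_add, map_sum] at h2
    have h3 : ∀ i ∈ Finset.range n, DD (hh ((i+1 : ℕ) : ℤ) * pp (n + 1 - (i+1))) =
        HN (i+1) * (Polynomial.C (pp (n + 1 - (i+1))) + Polynomial.X ^ (n + 1 - (i+1))) := by
      intro i hi
      have hi := Finset.mem_range.1 hi
      rw [map_mul, DD_hh_nat]
      congr 1
      have := ih (n - i - 1) (by omega)
      have e : n - i - 1 + 1 = n + 1 - (i+1) := by omega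
      rwa [e] at this
    rw [Finset.sum_congr rfl h3] at h2
    have h4 : DD (((n : SymFn) + 1) * hh ((n:ℤ)+1)) = ((n+1 : ℕ) : Polynomial SymFn) * HN (n+1) := by
      rw [map_mul, DD_hh, ext0_succ]; simp
    rw [h4, ← h1] at h2
    have h5 := add_left_cancel h2
    simpa [hh_zero, HN] using h5

lemma adams_h2 (k : ℕ) : adams k (hh 2) = (2:ℚ)⁻¹ • (pp k * pp k + pp (2 * k)) := by
  have : hh 2 = MvPolynomial.X 1 := by exact_mod_cast hh_succ 1
  rw [this]
  unfold adams
  rw [aeval_X]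
  simp only [hInP, Finset.sum_range_succ, Finset.sum_range_zero]
  have h0 : hInP 0 = 1 := by rw [hInP]
  simp [mul_comm, h0]
  norm_num

/-- The part of `p_k[h₂[X+t]]` of low degree. -/
noncomputable def QQ (k : ℕ) : Polynomial SymFn :=
  Polynomial.C (adams k (hh 2)) + Polynomial.C (pp k) * Polynomial.X ^ k

lemma degLE_QQ (k : ℕ) : degLE (QQ k) k := by
  refine ((degLE_C _).mono (by omega)).add ?_
  simpa using (degLE_C (pp k)).mul (degLE_X_pow k)

lemma DD_adams (k : ℕ) : DD (adams (k+1) (hh 2)) = QQ (k+1) + (Polynomial.X ^ 2) ^ (k+1) := by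
  rw [QQ, adams_h2, map_smul, map_add, map_mul, DD_pp]
  have : 2 * (k+1) = (2 * k + 1) + 1 := by ring
  rw [this, DD_pp, ← this]
  have h2 : (Polynomial.C ((2:ℚ)⁻¹ • (pp (k+1) * pp (k+1) + pp (2 * (k+1)))) : Polynomial SymFn) =
    (2:ℚ)⁻¹ • (Polynomial.C (pp (k+1)) * Polynomial.C (pp (k+1)) +
      Polynomial.C (pp (2 * (k+1)))) := by
    rw [← Polynomial.smul_C, map_add, map_mul]
  rw [h2]
  have h3 : ∀ p q : Polynomial SymFn, (2:ℚ) • p = (2:ℚ) • q → p = q := fun p q h =>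
    smul_right_injective _ (two_ne_zero) h
  apply h3
  simp only [smul_add, smul_smul]
  norm_num
  simp only [ofNat_smul_eq_nsmul, nsmul_eq_mul]
  ring

/-- `(h_k ∘ h₂)[X+t]` -/
noncomputable def BB (k : ℕ) : Polynomial SymFn := DD (hPleth (hh 2) k)

/-- the low degree factor -/
noncomputable def AA : ℕ → Polynomial SymFn
  | 0 => 1
  | (k+1) => BB (k+1) - Polynomial.X ^ 2 * BB k

lemma BB_zero : BB 0 = 1 := by simp [BB, hPleth]

lemma BB_rec (k : ℕ) : ((k : ℚ) + 1) • BB (k+1) =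
    ∑ i ∈ Finset.range (k+1), (QQ (i+1) + (Polynomial.X ^ 2) ^ (i+1)) * BB (k - i) := by
  have hk : ((k : ℚ) + 1) ≠ 0 := by positivity
  rw [BB, hPleth, map_smul, smul_smul, mul_inv_cancel₀ hk, one_smul, map_sum]
  apply Finset.sum_congr rfl
  intro i _
  rw [map_mul, DD_adams]; rfl

lemma BB_rec' (k : ℕ) : (k : Polynomial SymFn) * BB k =
    ∑ i ∈ Finset.range k, (QQ (i+1) + (Polynomial.X ^ 2) ^ (i+1)) * BB (k - (i+1)) := by
  cases k with
  | zero => simp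
  | succ k =>
    have := BB_rec k
    rw [Algebra.smul_def] at this
    simp only [Nat.add_sub_add_right]
    rw [← this]; simp

lemma AA_rec (k : ℕ) : ((k : Polynomial SymFn) + 1) * AA (k+1) =
    ∑ i ∈ Finset.range (k+1), QQ (i+1) * AA (k - i) := by
  have h1 := BB_rec' (k+1)
  have h2 := BB_rec' k
  have e1 : ∑ i ∈ Finset.range (k+1), QQ (i+1) * AA (k - i) =
      ∑ i ∈ Finset.range (k+1), QQ (i+1) * BB (k - i) -
      Polynomial.X ^ 2 * ∑ i ∈ Finset.range k, QQ (i+1) * BB (k - (i+1)) := by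
    rw [Finset.sum_range_succ, Finset.sum_range_succ _ k, Finset.mul_sum, add_sub_right_comm,
      ← Finset.sum_sub_distrib]
    congr 1
    · apply Finset.sum_congr rfl
      intro i hi
      have : k - i = (k - (i+1)) + 1 := by have := Finset.mem_range.1 hi; omega
      rw [this, AA]; ring
    · simp [AA, BB_zero]
  have e2 : ∑ i ∈ Finset.range (k+1), (Polynomial.X ^ 2 : Polynomial SymFn) ^ (i+1) * BB (k - i) =
      Polynomial.X ^ 2 * BB k +
      Polynomial.X ^ 2 * ∑ i ∈ Finset.range k, (Polynomial.X ^ 2) ^ (i+1) * BB (k - (i+1)) := by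
    rw [Finset.sum_range_succ', Finset.mul_sum, add_comm]
    refine congrArg₂ (· + ·) ?_ ?_
    · simp
    · apply Finset.sum_congr rfl
      intro i hi
      ring
  simp only [Nat.add_sub_add_right, add_mul, Finset.sum_add_distrib] at h1 h2
  rw [e2] at h1
  rw [e1, AA]
  push_cast at h1
  clear e1 e2
  generalize (Polynomial.X ^ 2 : Polynomial SymFn) = x at *
  linear_combination h1 - x * h2

lemma degLE_AA (k : ℕ) : degLE (AA k) k := by
  induction k using Nat.strong_induction_on with
  | _ k ih =>
    cases k with
    | zero => simpa [AA] using degLE_one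
    | succ k =>
      have hk : ((k : ℚ) + 1) ≠ 0 := by positivity
      have h : AA (k+1) = ((k:ℚ)+1)⁻¹ • ∑ i ∈ Finset.range (k+1), QQ (i+1) * AA (k - i) := by
        rw [← AA_rec, eq_inv_smul_iff₀ hk, Algebra.smul_def]; simp
      rw [h]
      apply degLE.smul
      apply degLE_sum
      intro i hi
      have hi := Finset.mem_range.1 hi
      exact ((degLE_QQ (i+1)).mul (ih (k - i) (by omega))).mono (by push_cast; omega)

lemma degLE_BB (k : ℕ) : degLE (BB k) (2 * k) := by
  induction k with
  | zero => simpa [BB_zero] using degLE_one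
  | succ k ih =>
    have : BB (k+1) = AA (k+1) + Polynomial.X ^ 2 * BB k := by rw [AA]; ring
    rw [this]
    refine ((degLE_AA (k+1)).mono (by push_cast; omega)).add ?_
    exact ((degLE_X_pow 2).mul ih).mono (by push_cast; omega)

lemma degLE_ext0 (f : ℕ → Polynomial SymFn) (r : ℤ) (h : ∀ k : ℕ, degLE (f k) (r * k)) (n : ℤ) :
    degLE (ext0 f n) (r * n) := by
  by_cases hn : n < 0
  · rw [ext0_neg _ hn]; exact degLE_zero _
  · obtain ⟨k, rfl⟩ := Int.eq_ofNat_of_zero_le (not_lt.mp hn)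
    rw [ext0_nat]; exact h k

lemma BZ_rec (n : ℤ) : ext0 BB n = ext0 AA n + Polynomial.X ^ 2 * ext0 BB (n - 1) := by
  rcases int_cases n with h | rfl | ⟨k, rfl⟩
  · rw [ext0_neg _ h, ext0_neg _ h, ext0_neg _ (by omega)]; simp
  · rw [ext0_zero, ext0_zero, ext0_neg _ (by omega)]; simp [AA, BB_zero]
  · rw [ext0_succ, ext0_succ, add_sub_cancel_right, ext0_nat, AA]; ring

/-- `f ↦ (f ∘ h₂)[X+t]` -/
noncomputable def TT : SymFn →ₐ[ℚ] Polynomial SymFn :=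
  DD.comp (aeval fun m => hPleth (hh 2) (m+1))

lemma TT_hh (n : ℤ) : TT (hh n) = ext0 BB n :=
  algHom_hh _ _ BB_zero (fun m => by simp [TT, BB]) n

lemma degLE_TT (n : ℕ) (v : ℕ → ℕ) (M : ℕ) (hv : ∀ i, v i ≤ M) :
    degLE (TT (jt n v)) ((∑ i : Fin n, (v i : ℤ)) + M) := by
  cases n with
  | zero =>
    simp only [jt, Matrix.det_fin_zero, map_one]
    exact degLE_one.mono (by simp)
  | succ n =>
    rw [map_jt]
    simp only [TT_hh]
    rw [det_col (ext0 AA) (ext0 BB) _ BZ_rec, Matrix.det_apply']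
    apply degLE_sum
    intro σ _
    have hsgn : degLE (((Equiv.Perm.sign σ : ℤ) : Polynomial SymFn)) 0 := by
      simpa using degLE_C ((Equiv.Perm.sign σ : ℤ) : SymFn)
    have hp := degLE_prod Finset.univ (fun i => (Matrix.of fun i j : Fin (n+1) =>
      if j = 0 then ext0 BB ((v i : ℤ) - (i:ℤ)) else
        ext0 AA ((v i : ℤ) + (j:ℤ) - (i:ℤ))) (σ i) i)
      (fun j => ((v (σ j) : ℤ) + (j:ℤ) - (σ j : ℕ)) +
        if j = 0 then ((v (σ 0) : ℤ) - (σ 0 : ℕ)) else 0) (by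
      intro j _
      simp only [Matrix.of_apply]
      split_ifs with h
      · subst h
        refine (degLE_ext0 BB 2 degLE_BB _).mono (by simp; omega)
      · refine (degLE_ext0 AA 1 (by simpa using degLE_AA) _).mono (by omega))
    refine (hsgn.mul hp).mono ?_
    rw [Finset.sum_add_distrib, Finset.sum_sub_distrib, Finset.sum_add_distrib,
      Equiv.sum_comp σ (fun i => (v i : ℤ)), Equiv.sum_comp σ (fun i => ((i : ℕ) : ℤ))]
    simp only [Finset.sum_ite_eq', Finset.mem_univ, if_true]
    have := hv (σ 0)
    omega

end PhiProof

/-- Every partition `κ` appearing with nonzero coefficient in the Schur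
expansion of `s_λ ∘ h₂` satisfies `κ₁ ≤ |λ| + λ₁`; i.e. `Φ(s_λ ∘ h₂) ≤ |λ| + λ₁`. -/
theorem phi_schur_pleth_h2_le
    (lam : Multiset ℕ) (hlam : IsPartition lam)
    (c : Multiset ℕ →₀ ℚ) (hc : SchurExpansion (pleth (schur lam) (hh 2)) c) :
    (∀ κ ∈ c.support, firstPart κ ≤ psize lam + firstPart lam) ∧
      Phi c ≤ psize lam + firstPart lam := by
  have hdeg : PhiProof.degLE (PhiProof.DD (pleth (schur lam) (hh 2)))
      ((psize lam + firstPart lam : ℕ) : ℤ) := by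
    have h := PhiProof.degLE_TT (Multiset.card lam) (PhiProof.vv lam) lam.sup
      (PhiProof.vv_le lam)
    have hs : (∑ i : Fin (Multiset.card lam), (PhiProof.vv lam i : ℤ)) = (lam.sum : ℤ) := by
      exact_mod_cast PhiProof.sum_vv lam
    rw [hs] at h
    exact_mod_cast h
  have key : ∀ κ ∈ c.support, firstPart κ ≤ psize lam + firstPart lam := by
    obtain ⟨hp, hf⟩ := hc
    by_contra! hcon
    obtain ⟨κ₁, hκ₁, hgt⟩ := hcon
    obtain ⟨κ₀, hκ₀, hmax⟩ :=
      Finset.exists_max_image c.support (fun κ => κ.sup) ⟨κ₁, hκ₁⟩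
    have hM : psize lam + firstPart lam < κ₀.sup := lt_of_lt_of_le hgt (hmax κ₁ hκ₁)
    have hl := PhiProof.lead c.support c κ₀.sup (by omega) hmax
    have h0 := hdeg κ₀.sup (by exact_mod_cast hM)
    rw [hf, Finsupp.sum, hl] at h0
    have hcons : κ₀.sup ::ₘ κ₀.erase κ₀.sup = κ₀ :=
      Multiset.cons_erase (PhiProof.sup_mem κ₀ (by omega))
    have h1 := PhiProof.indep _ _ (fun μ => c (κ₀.sup ::ₘ μ)) (fun μ hμ => ⟨?_,
      Finset.le_sup (f := Multiset.card) hμ⟩) h0 (κ₀.erase κ₀.sup)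
      (Finset.mem_image.2 ⟨κ₀, Finset.mem_filter.2 ⟨hκ₀, rfl⟩, rfl⟩)
    · simp only [hcons] at h1
      exact (Finsupp.mem_support_iff.1 hκ₀) h1
    · obtain ⟨κ, hκ, rfl⟩ := Finset.mem_image.1 hμ
      exact fun hz => hp κ (Finset.mem_filter.1 hκ).1 (Multiset.mem_of_mem_erase hz)
  exact ⟨key, Finset.sup_le key⟩
end

section
/- Let μ be a partition. Then every partition κ appearing with nonzero coefficient in the Schur expansion of s_μ ∘ e₂ satisfies κ₁ ≤ |μ|; equivalently, Φ(s_μ ∘ e₂) ≤ |μ|. -/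
open MvPolynomial Finset

namespace PhiAux

/-- Adjoining one new variable `t`: `h_n ↦ ∑ t^j h_{n-j}`. -/
noncomputable def HN (n : ℕ) : Polynomial SymFn :=
  ∑ j ∈ Finset.range (n+1), Polynomial.C (hh ((n - j : ℕ) : ℤ)) * Polynomial.X ^ j

noncomputable def Del : SymFn →ₐ[ℚ] Polynomial SymFn := aeval fun m => HN (m+1)

noncomputable def HZ (n : ℤ) : Polynomial SymFn := Del (hh n)

lemma hh_zero : hh 0 = 1 := by simp [hh]

lemma hh_neg {n : ℤ} (h : n < 0) : hh n = 0 := by simp [hh, h]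

lemma hh_succ (n : ℕ) : hh ((n : ℤ) + 1) = X n := by
  unfold hh
  rw [if_neg (by omega), if_neg (by omega)]
  congr 1

lemma HZ_nat (n : ℕ) : HZ n = HN n := by
  cases n with
  | zero => simp [HZ, HN, hh_zero]
  | succ n =>
    push_cast
    rw [HZ, hh_succ]; simp [Del]

lemma HZ_neg {n : ℤ} (h : n < 0) : HZ n = 0 := by simp [HZ, hh_neg h]

lemma gen_succ {R : Type*} [CommRing R] (x : R) (g : ℕ → R) (n : ℕ) :
    ∑ j ∈ Finset.range (n+1+1), g (n + 1 - j) * x ^ j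
      = g (n+1) + x * ∑ j ∈ Finset.range (n+1), g (n - j) * x ^ j := by
  rw [Finset.sum_range_succ', Finset.mul_sum, add_comm]
  simp only [Nat.sub_zero, pow_zero, mul_one, Nat.add_sub_add_right]
  congr 1
  refine Finset.sum_congr rfl fun j _ => ?_
  ring

lemma HN_succ (n : ℕ) :
    HN (n+1) = Polynomial.C (hh ((n : ℤ) + 1)) + Polynomial.X * HN n := by
  have := gen_succ (Polynomial.X : Polynomial SymFn) (fun n => Polynomial.C (hh (n : ℤ))) n
  rw [Nat.cast_succ] at this
  exact this

lemma HN_zero : HN 0 = 1 := by simp [HN, hh_zero]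

lemma HZ_rec (n : ℤ) : HZ n = Polynomial.C (hh n) + Polynomial.X * HZ (n - 1) := by
  rcases lt_trichotomy n 0 with h | h | h
  · rw [HZ_neg h, HZ_neg (by omega), hh_neg h]; simp
  · subst h
    rw [HZ_neg (show (0:ℤ) - 1 < 0 by omega), hh_zero]
    simp [HZ, hh_zero]
  · obtain ⟨m, rfl⟩ : ∃ m : ℕ, n = (m : ℤ) + 1 := ⟨(n - 1).toNat, by omega⟩
    have := HN_succ m
    rw [← HZ_nat, ← HZ_nat] at this
    push_cast at this
    simpa using this

lemma HN_natDegree (n : ℕ) : (HN n).natDegree ≤ n := by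
  unfold HN
  refine Polynomial.natDegree_sum_le_of_forall_le _ _ fun j hj => ?_
  refine (Polynomial.natDegree_C_mul_X_pow_le _ _).trans ?_
  simp at hj; omega

lemma HN_coeff_top (n : ℕ) : (HN n).coeff n = 1 := by
  induction n with
  | zero => simp [HN_zero]
  | succ n ih =>
    rw [HN_succ]
    simp [ih]

lemma HZ_coeff_of_lt {n : ℤ} {k : ℕ} (h : n < k) : (HZ n).coeff k = 0 := by
  by_cases hn : n < 0
  · simp [HZ_neg hn]
  · obtain ⟨m, rfl⟩ : ∃ m : ℕ, n = (m : ℤ) := ⟨n.toNat, by omega⟩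
    rw [HZ_nat]
    exact Polynomial.coeff_eq_zero_of_natDegree_lt (lt_of_le_of_lt (HN_natDegree m) (by omega))

lemma Del_hh (n : ℤ) : Del (hh n) = HZ n := rfl

/-! ### Power sums -/

lemma pp_newton (k : ℕ) :
    ∑ i ∈ Finset.range (k+1), hh (i : ℤ) * pp (k + 1 - i) = ((k : ℚ) + 1) • hh ((k : ℤ) + 1) := by
  rw [Finset.sum_range_succ']
  simp only [Nat.cast_zero, hh_zero, one_mul, Nat.sub_zero]
  rw [pp]
  have : ∀ i ∈ Finset.range k, hh ((i + 1 : ℕ) : ℤ) * pp (k + 1 - (i + 1))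
      = hh ((i : ℤ) + 1) * pp (k - i) := by
    intro i _
    rw [show k + 1 - (i + 1) = k - i by omega]; push_cast; rfl
  rw [Finset.sum_congr rfl this]
  exact add_sub_cancel _ _

lemma gen_newton {R : Type*} [CommRing R] (x : R) (h p H : ℕ → R) (h0 : h 0 = 1) (H0 : H 0 = 1)
    (hH : ∀ n, H (n+1) = h (n+1) + x * H n)
    (hp : ∀ k : ℕ, ∑ i ∈ Finset.range (k+1), h i * p (k + 1 - i) = ((k : R) + 1) * h (k+1))
    (k : ℕ) :
    ∑ i ∈ Finset.range (k+1), H i * (p (k + 1 - i) + x ^ (k + 1 - i))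
      = ((k : R) + 1) * H (k+1) := by
  induction k with
  | zero =>
    have h1 := hp 0
    simp [h0] at h1
    simp [hH, H0, h1]
  | succ k ih =>
    have key : ∑ i ∈ Finset.range (k+1+1),
        H i * (p (k + 1 + 1 - i) + x ^ (k + 1 + 1 - i))
        = (∑ i ∈ Finset.range (k+1+1), h i * p (k + 1 + 1 - i))
          + x * H (k+1)
          + x * ∑ i ∈ Finset.range (k+1), H i * (p (k + 1 - i) + x ^ (k + 1 - i)) := by
      have hA : ∑ i ∈ Finset.range (k+1+1), H i * p (k + 1 + 1 - i)
          = (∑ i ∈ Finset.range (k+1+1), h i * p (k + 1 + 1 - i))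
            + x * ∑ i ∈ Finset.range (k+1), H i * p (k + 1 - i) := by
        rw [Finset.sum_range_succ', Finset.sum_range_succ' _ (k+1)]
        simp only [hH, H0, h0, Finset.mul_sum, add_mul, Finset.sum_add_distrib,
          Nat.add_sub_add_right, mul_assoc]
        ring
      have hB : ∑ i ∈ Finset.range (k+1+1), H i * x ^ (k + 1 + 1 - i)
          = x * H (k+1) + x * ∑ i ∈ Finset.range (k+1), H i * x ^ (k + 1 - i) := by
        rw [Finset.sum_range_succ, Finset.mul_sum, add_comm]
        congr 1
        · rw [show k + 1 + 1 - (k + 1) = 1 by omega]; ring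
        · refine Finset.sum_congr rfl fun i hi => ?_
          simp at hi
          rw [show k + 1 + 1 - i = (k + 1 - i) + 1 by omega]; ring
      simp only [mul_add, Finset.sum_add_distrib]
      rw [hA, hB]; ring
    rw [key, ih, hp, hH (k+1)]
    push_cast
    ring

lemma HN_newton (k : ℕ) :
    ∑ i ∈ Finset.range (k+1), HN i * (Polynomial.C (pp (k + 1 - i)) + Polynomial.X ^ (k + 1 - i))
      = ((k : ℚ) + 1) • HN (k+1) := by
  have := gen_newton (Polynomial.X : Polynomial SymFn) (fun n => Polynomial.C (hh (n : ℤ)))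
    (fun n => Polynomial.C (pp n)) HN (by simp [hh_zero]) HN_zero
    (fun n => by simpa using HN_succ n)
    (fun k => by
      have := congrArg (Polynomial.C : SymFn →+* Polynomial SymFn) (pp_newton k)
      rw [Algebra.smul_def] at this
      simpa only [map_sum, map_mul, map_add, map_one, map_natCast, Nat.cast_succ] using this) k
  rw [this, Algebra.smul_def]
  simp only [map_add, map_one, map_natCast]

lemma Del_newton (k : ℕ) :
    ∑ i ∈ Finset.range (k+1), HN i * Del (pp (k + 1 - i)) = ((k : ℚ) + 1) • HN (k+1) := by
  have := congrArg Del (pp_newton k)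
  simp only [map_sum, map_mul, map_smul, Del_hh, HZ_nat] at this
  rw [this, ← HZ_nat]; push_cast; rfl

lemma Del_pp (k : ℕ) (hk : 0 < k) : Del (pp k) = Polynomial.C (pp k) + Polynomial.X ^ k := by
  induction k using Nat.strong_induction_on with
  | _ k ih =>
    obtain ⟨k, rfl⟩ : ∃ m, k = m + 1 := ⟨k - 1, by omega⟩
    have h1 := (Del_newton k).trans (HN_newton k).symm
    rw [Finset.sum_range_succ', Finset.sum_range_succ' _ k] at h1
    have h2 : ∀ i ∈ Finset.range k, HN (i+1) * Del (pp (k + 1 - (i+1)))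
        = HN (i+1) * (Polynomial.C (pp (k + 1 - (i+1))) + Polynomial.X ^ (k + 1 - (i+1))) := by
      intro i hi
      simp at hi
      rw [ih (k + 1 - (i+1)) (by omega) (by omega)]
    rw [Finset.sum_congr rfl h2] at h1
    simpa [HN_zero] using h1

/-! ### Plethysm with `e₂` -/

lemma ee_two : ee 2 = X 0 * X 0 - X 1 := by
  have h1 := hh_succ 0
  have h2 := hh_succ 1
  norm_num at h1 h2
  simp [ee, Finset.sum_range_succ, h1, h2]
  ring

lemma hInP_one : hInP 1 = X 0 := by
  simp [hInP]

lemma hInP_two : hInP 2 = (2 : ℚ)⁻¹ • (X 0 * X 0 + X 1) := by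
  rw [hInP]
  simp [Finset.sum_range_succ, hInP]
  norm_num

lemma adams_ee_two (k : ℕ) :
    adams k (ee 2) = (2 : ℚ)⁻¹ • (pp k * pp k - pp (k * 2)) := by
  rw [ee_two]
  simp only [adams, map_sub, map_mul, aeval_X, zero_add, hInP_one,
    show (1 + 1 : ℕ) = 2 from rfl, hInP_two, map_smul, map_add]
  simp only [mul_one]
  simp only [Algebra.smul_def]
  have : (algebraMap ℚ SymFn) 2⁻¹ * 2 = 1 := by
    rw [show (2 : SymFn) = algebraMap ℚ SymFn 2 from (map_ofNat _ 2).symm, ← map_mul]; norm_num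
  linear_combination (-(pp k * pp k)) * this

lemma Del_adams (k : ℕ) (hk : 0 < k) : (Del (adams k (ee 2))).natDegree ≤ k := by
  rw [adams_ee_two, map_smul]
  refine (Polynomial.natDegree_smul_le _ _).trans ?_
  rw [map_sub, map_mul, Del_pp k hk, Del_pp _ (by omega)]
  have : (Polynomial.C (pp k) + Polynomial.X ^ k) * (Polynomial.C (pp k) + Polynomial.X ^ k)
      - (Polynomial.C (pp (k*2)) + Polynomial.X ^ (k*2))
      = Polynomial.C (pp k * pp k - pp (k*2)) + Polynomial.C (2 * pp k) * Polynomial.X ^ k := by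
    simp only [map_sub, map_mul, map_ofNat]; ring
  rw [this]
  refine Polynomial.natDegree_add_le_of_degree_le ?_ (Polynomial.natDegree_C_mul_X_pow_le _ _)
  rw [Polynomial.natDegree_C]
  exact Nat.zero_le _

lemma Del_hPleth (k : ℕ) : (Del (hPleth (ee 2) k)).natDegree ≤ k := by
  induction k using Nat.strong_induction_on with
  | _ k ih =>
    cases k with
    | zero => simp [hPleth]
    | succ k =>
      rw [hPleth, map_smul, map_sum]
      refine (Polynomial.natDegree_smul_le _ _).trans ?_
      refine Polynomial.natDegree_sum_le_of_forall_le _ _ fun i hi => ?_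
      simp at hi
      rw [map_mul]
      refine Polynomial.natDegree_mul_le.trans ?_
      have h1 := Del_adams (i+1) (by omega)
      have h2 := ih (k - i) (by omega)
      omega

/-! ### Determinants -/

noncomputable def DD (n : ℕ) (a : ℕ → ℕ) : SymFn :=
  Matrix.det (Matrix.of fun i j : Fin n => hh ((a i : ℤ) + (j : ℤ) - (i : ℤ)))

lemma schur_eq (m : Multiset ℕ) :
    schur m = DD (Multiset.card m) (fun i => (sortedParts m).getD i 0) := rfl

noncomputable def plE : SymFn →ₐ[ℚ] SymFn := aeval (fun m => hPleth (ee 2) (m+1))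

lemma plE_hh_nat (n : ℕ) : plE (hh n) = hPleth (ee 2) n := by
  cases n with
  | zero => simp [hh_zero, hPleth]
  | succ n => push_cast; rw [hh_succ]; simp [plE]

lemma pleth_DD (n : ℕ) (a : ℕ → ℕ) :
    (Del (pleth (DD n a) (ee 2))).natDegree ≤ ∑ i : Fin n, a i := by
  change (Del (plE (DD n a))).natDegree ≤ _
  rw [DD, AlgHom.map_det, AlgHom.map_det, Matrix.det_apply]
  refine Polynomial.natDegree_sum_le_of_forall_le _ _ fun σ _ => ?_
  refine (Polynomial.natDegree_smul_le _ _).trans ?_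
  simp only [AlgHom.mapMatrix_apply, Matrix.map_apply, Matrix.of_apply]
  by_cases h : ∃ i : Fin n, (a (σ i) : ℤ) + (i : ℤ) - ((σ i : Fin n) : ℤ) < 0
  · obtain ⟨i, hi⟩ := h
    rw [Finset.prod_eq_zero (Finset.mem_univ i)]
    · simp
    · rw [hh_neg hi]; simp
  · push Not at h
    refine (Polynomial.natDegree_prod_le _ _).trans ?_
    have h1 : ∀ i : Fin n, ((Del (plE (hh ((a (σ i) : ℤ) + (i : ℤ) - ((σ i : Fin n) : ℤ))))).natDegree : ℤ)
        ≤ (a (σ i) : ℤ) + (i : ℤ) - ((σ i : Fin n) : ℤ) := by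
      intro i
      obtain ⟨m, hm⟩ := Int.eq_ofNat_of_zero_le (h i)
      rw [hm, plE_hh_nat]
      exact_mod_cast Del_hPleth m
    zify
    refine (Finset.sum_le_sum fun i _ => h1 i).trans ?_
    rw [Finset.sum_sub_distrib, Finset.sum_add_distrib,
      Equiv.sum_comp σ (fun i : Fin n => (a i : ℤ)), Equiv.sum_comp σ (fun i : Fin n => ((i : ℕ) : ℤ))]
    simp

lemma Del_DD (n : ℕ) (a : ℕ → ℕ) :
    Del (DD (n+1) a) = ∑ i : Fin (n+1), (-1) ^ (i : ℕ) * HZ ((a i : ℤ) - (i : ℤ)) *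
      Polynomial.C (Matrix.det (Matrix.of fun (p q : Fin n) =>
        hh ((a (i.succAbove p) : ℤ) + ((q.succ : Fin (n+1)) : ℤ) - ((i.succAbove p : Fin (n+1)) : ℤ)))) := by
  rw [DD, AlgHom.map_det]
  rw [Matrix.det_eq_of_forall_col_eq_smul_add_pred (B := Matrix.of fun i j : Fin (n+1) =>
    if j = 0 then HZ ((a i : ℤ) - (i : ℤ)) else
      Polynomial.C (hh ((a i : ℤ) + (j : ℤ) - (i : ℤ)))) (c := fun _ => Polynomial.X)]
  · rw [Matrix.det_succ_column_zero]
    refine Finset.sum_congr rfl fun i _ => ?_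
    congr 1
    rw [RingHom.map_det]
    congr 1
  · intro i
    simp [Del_hh]
  · intro i j
    simp only [AlgHom.mapMatrix_apply, Matrix.map_apply, Matrix.of_apply, Del_hh]
    rw [HZ_rec, if_neg (Fin.succ_ne_zero j)]
    congr 3
    simp; ring

lemma Del_DD_coeff (n : ℕ) (a : ℕ → ℕ) (ha : ∀ i, a i ≤ a 0) (k : ℕ) (hk : a 0 ≤ k) :
    (Del (DD (n+1) a)).coeff k = if k = a 0 then DD n (fun i => a (i+1)) else 0 := by
  rw [Del_DD, Polynomial.finsetSum_coeff, Fin.sum_univ_succ, Finset.sum_eq_zero, add_zero]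
  · rw [Polynomial.coeff_mul_C]
    simp only [Fin.val_zero, pow_zero, one_mul, Nat.cast_zero, sub_zero]
    rw [HZ_nat]
    split_ifs with h
    · subst h
      rw [HN_coeff_top, one_mul, DD]
      congr 1
      ext1 p q
      simp only [Matrix.of_apply, Fin.succAbove_zero, Fin.val_succ]
      congr 1
      push_cast; ring
    · rw [Polynomial.coeff_eq_zero_of_natDegree_lt, zero_mul]
      exact lt_of_le_of_lt (HN_natDegree _) (by omega)
  · intro i _
    rw [Polynomial.coeff_mul_C]
    have h0 : (HZ ((a i.succ : ℤ) - (i.succ : Fin (n+1)))).coeff k = 0 := by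
      apply HZ_coeff_of_lt
      have := ha i.succ
      simp only [Fin.val_succ] at *
      push_cast
      omega
    rcases neg_one_pow_eq_or (Polynomial SymFn) ((i.succ : Fin (n+1)) : ℕ) with h | h <;>
      rw [h] <;> simp only [one_mul, neg_mul, Polynomial.coeff_neg, h0, zero_mul, neg_zero]

/-! ### Sorted parts -/

lemma sortedParts_coe (m : Multiset ℕ) : (sortedParts m : Multiset ℕ) = m := by
  simp [sortedParts]

lemma sortedParts_pairwise (m : Multiset ℕ) : (sortedParts m).Pairwise (· ≥ ·) := by
  rw [sortedParts, List.pairwise_reverse]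
  exact Multiset.pairwise_sort m (· ≤ ·)

lemma sortedParts_unique (m : Multiset ℕ) (l : List ℕ) (hl : l.Pairwise (· ≥ ·))
    (h : (l : Multiset ℕ) = m) : sortedParts m = l := by
  have hp : (sortedParts m).Perm l := by
    rw [← Multiset.coe_eq_coe, sortedParts_coe, h]
  exact hp.eq_of_pairwise (fun a b _ _ h1 h2 => le_antisymm h2 h1) (sortedParts_pairwise m) hl

lemma sup_mem (m : Multiset ℕ) (h : m ≠ 0) : m.sup ∈ m := by
  induction m using Multiset.induction_on with
  | empty => exact absurd rfl h
  | cons a s ih =>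
    rw [Multiset.sup_cons]
    by_cases hs : s = 0
    · simp [hs]
    · rcases le_total a s.sup with h | h
      · rw [sup_eq_right.2 h]; exact Multiset.mem_cons_of_mem (ih hs)
      · rw [sup_eq_left.2 h]; exact Multiset.mem_cons_self _ _

lemma sortedParts_cons (m : Multiset ℕ) (h : m ≠ 0) :
    sortedParts m = m.sup :: sortedParts (m.erase m.sup) := by
  apply sortedParts_unique
  · rw [List.pairwise_cons]
    refine ⟨fun b hb => ?_, sortedParts_pairwise _⟩
    rw [← Multiset.mem_coe, sortedParts_coe] at hb
    exact Multiset.le_sup (Multiset.mem_of_mem_erase hb)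
  · rw [← Multiset.cons_coe, sortedParts_coe, Multiset.cons_erase (sup_mem m h)]

lemma schur_zero : schur 0 = 1 := by
  rw [schur_eq, DD]
  exact Matrix.det_fin_zero

lemma schur_coeff (m : Multiset ℕ) (h : m ≠ 0) (k : ℕ) (hk : firstPart m ≤ k) :
    (Del (schur m)).coeff k = if k = firstPart m then schur (m.erase k) else 0 := by
  have hc : Multiset.card m = Multiset.card (m.erase m.sup) + 1 :=
    (Multiset.card_erase_add_one (sup_mem m h)).symm
  rw [schur_eq, hc, sortedParts_cons m h, Del_DD_coeff]
  · simp only [List.getD_cons_zero, List.getD_cons_succ]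
    unfold firstPart
    split_ifs with hh'
    · subst hh'; rfl
    · rfl
  · intro i
    rw [List.getD_cons_zero, ← sortedParts_cons m h]
    rw [List.getD_eq_getElem?_getD]
    rcases lt_or_ge i (sortedParts m).length with hi | hi
    · rw [List.getElem?_eq_getElem hi]
      apply Multiset.le_sup
      have hm : (sortedParts m)[i] ∈ (sortedParts m : Multiset ℕ) :=
        Multiset.mem_coe.2 (List.getElem_mem hi)
      rw [sortedParts_coe] at hm
      exact hm
    · rw [List.getElem?_eq_none hi]; simp
  · simpa [firstPart] using hk

lemma sum_sorted (m : Multiset ℕ) :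
    ∑ i : Fin (Multiset.card m), (sortedParts m).getD i 0 = m.sum := by
  have hl : Multiset.card m = (sortedParts m).length := by
    conv_lhs => rw [← sortedParts_coe m]
    simp
  conv_rhs => rw [← sortedParts_coe m, Multiset.sum_coe]
  rw [Fin.sum_univ_eq_sum_range (fun i => (sortedParts m).getD i 0), hl]
  generalize sortedParts m = l
  rw [← Fin.sum_univ_eq_sum_range (fun i => l.getD i 0), ← Fin.sum_univ_getElem]
  refine Finset.sum_congr rfl fun i _ => ?_
  simp

/-! ### Independence and first parts -/

def Indep (n : ℕ) : Prop := ∀ (s : Finset (Multiset ℕ)) (c : Multiset ℕ → ℚ),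
  (∀ κ ∈ s, IsPartition κ ∧ Multiset.card κ ≤ n) →
  ∑ κ ∈ s, c κ • schur κ = 0 → ∀ κ ∈ s, c κ = 0

lemma first_le (n N : ℕ) (hn : Indep n) (s : Finset (Multiset ℕ)) (c : Multiset ℕ → ℚ)
    (hs : ∀ κ ∈ s, IsPartition κ ∧ Multiset.card κ ≤ n + 1) (hc : ∀ κ ∈ s, c κ ≠ 0)
    (hd : (Del (∑ κ ∈ s, c κ • schur κ)).natDegree ≤ N) :
    ∀ κ ∈ s, firstPart κ ≤ N := by
  by_contra! hcon
  obtain ⟨κ₁, h₁, hlt⟩ := hcon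
  obtain ⟨κ₀, h₀, hmax⟩ := Finset.exists_max_image s firstPart ⟨κ₁, h₁⟩
  set M := firstPart κ₀ with hM
  have hNM : N < M := hlt.trans_le (hmax κ₁ h₁)
  have hco : (Del (∑ κ ∈ s, c κ • schur κ)).coeff M = 0 :=
    Polynomial.coeff_eq_zero_of_natDegree_lt (by omega)
  have hne : ∀ κ : Multiset ℕ, firstPart κ = M → M ∈ κ := by
    intro κ hκ
    rw [← hκ]
    apply sup_mem
    rintro rfl
    simp [firstPart] at hκ
    omega
  have hcoef : ∀ κ ∈ s, (Del (schur κ)).coeff M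
      = if firstPart κ = M then schur (κ.erase M) else 0 := by
    intro κ hκ
    by_cases h0 : κ = 0
    · subst h0
      have : firstPart (0 : Multiset ℕ) = 0 := by simp [firstPart]
      rw [schur_zero, map_one, this, if_neg (by omega), Polynomial.coeff_one, if_neg (by omega)]
    · rw [schur_coeff κ h0 M (hmax κ hκ)]
      simp only [eq_comm]
  rw [map_sum, Polynomial.finsetSum_coeff] at hco
  have hco2 : ∑ κ ∈ s with firstPart κ = M, c κ • schur (κ.erase M) = 0 := by
    rw [Finset.sum_filter]
    refine Eq.trans ?_ hco
    refine Finset.sum_congr rfl fun κ hκ => ?_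
    rw [map_smul, Polynomial.coeff_smul, hcoef κ hκ]
    split_ifs
    · rfl
    · rw [smul_zero]
  have hinj : Set.InjOn (fun κ : Multiset ℕ => κ.erase M)
      (s.filter fun κ => firstPart κ = M : Finset (Multiset ℕ)) := by
    intro x hx y hy hxy
    simp only [Finset.coe_filter, Set.mem_ofPred_eq] at hx hy
    rw [← Multiset.cons_erase (hne x hx.2), ← Multiset.cons_erase (hne y hy.2)]
    exact congrArg _ hxy
  have := hn ((s.filter fun κ => firstPart κ = M).image fun κ => κ.erase M)
    (fun l => c (M ::ₘ l)) (by
      intro κ hκ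
      obtain ⟨x, hx, rfl⟩ := Finset.mem_image.1 hκ
      rw [Finset.mem_filter] at hx
      obtain ⟨hp, hcard⟩ := hs x hx.1
      refine ⟨fun hz => hp (Multiset.mem_of_mem_erase hz), ?_⟩
      have := Multiset.card_erase_add_one (hne x hx.2)
      omega) (by
      rw [Finset.sum_image hinj, ← hco2]
      refine Finset.sum_congr rfl fun κ hκ => ?_
      rw [Finset.mem_filter] at hκ
      rw [Multiset.cons_erase (hne κ hκ.2)]) (κ₀.erase M)
      (Finset.mem_image_of_mem _ (by simp [h₀, hM]))
  rw [Multiset.cons_erase (hne κ₀ rfl)] at this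
  exact hc κ₀ h₀ this

lemma eq_zero_of_first (κ : Multiset ℕ) (hp : IsPartition κ) (h : firstPart κ = 0) : κ = 0 := by
  by_contra hne
  have := sup_mem κ hne
  rw [show κ.sup = 0 from h] at this
  exact hp this

lemma indep_of_zero (s : Finset (Multiset ℕ)) (c : Multiset ℕ → ℚ) (hz : ∀ κ ∈ s, κ = 0)
    (h : ∑ κ ∈ s, c κ • schur κ = 0) : ∀ κ ∈ s, c κ = 0 := by
  intro κ hκ
  have hs : s = {κ} := by
    ext x
    rw [Finset.mem_singleton]
    exact ⟨fun hx => (hz x hx).trans (hz κ hκ).symm, fun hx => hx ▸ hκ⟩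
  rw [hs, Finset.sum_singleton, hz κ hκ, schur_zero] at h
  rw [hz κ hκ]
  simpa using h

lemma indep (n : ℕ) : Indep n := by
  induction n with
  | zero =>
    intro s c hs h
    exact indep_of_zero s c (fun κ hκ => Multiset.card_eq_zero.1 (by have := (hs κ hκ).2; omega)) h
  | succ n ih =>
    intro s c hs h
    have hsum : ∑ κ ∈ s with c κ ≠ 0, c κ • schur κ = 0 := by
      rw [← h, Finset.sum_filter]
      refine Finset.sum_congr rfl fun κ _ => ?_
      split_ifs with hh'
      · rfl
      · simp [not_not.1 hh']
    have hf := first_le n 0 ih (s.filter fun κ => c κ ≠ 0) c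
      (fun κ hκ => hs κ (Finset.mem_filter.1 hκ).1) (fun κ hκ => (Finset.mem_filter.1 hκ).2)
      (by rw [hsum]; simp)
    have h0 := indep_of_zero (s.filter fun κ => c κ ≠ 0) c
      (fun κ hκ => eq_zero_of_first κ (hs κ (Finset.mem_filter.1 hκ).1).1
        (Nat.le_zero.1 (hf κ hκ))) hsum
    intro κ hκ
    by_contra hne
    exact hne (h0 κ (Finset.mem_filter.2 ⟨hκ, hne⟩))

end PhiAux

/-- Every partition `κ` appearing with nonzero coefficient in the Schur
expansion of `s_μ ∘ e₂` satisfies `κ₁ ≤ |μ|`; i.e. `Φ(s_μ ∘ e₂) ≤ |μ|`. -/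
theorem phi_schur_pleth_e2_le
    (mu : Multiset ℕ) (hmu : IsPartition mu)
    (c : Multiset ℕ →₀ ℚ) (hc : SchurExpansion (pleth (schur mu) (ee 2)) c) :
    (∀ κ ∈ c.support, firstPart κ ≤ psize mu) ∧ Phi c ≤ psize mu := by
  have hdeg : (PhiAux.Del (pleth (schur mu) (ee 2))).natDegree ≤ psize mu := by
    rw [PhiAux.schur_eq]
    refine (PhiAux.pleth_DD _ _).trans ?_
    exact (PhiAux.sum_sorted mu).le
  obtain ⟨hp, hf⟩ := hc
  rw [hf, Finsupp.sum] at hdeg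
  have hmain := PhiAux.first_le (c.support.sup Multiset.card) (psize mu) (PhiAux.indep _)
    c.support c
    (fun κ hκ => ⟨hp κ hκ, (Finset.le_sup (f := Multiset.card) hκ).trans (Nat.le_succ _)⟩)
    (fun κ hκ => Finsupp.mem_support_iff.1 hκ) hdeg
  exact ⟨hmain, Finset.sup_le hmain⟩
end
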